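/- arXiv:2204.08553 — 10 statements merged into one kernel-verified Lean document; each statement's English description precedes it below -/
import Mathlib

section
/- Let m, n be positive integers with gcd(m, n) = 1, and let K ⊂ ℝ³ be the (m, n) torus knot, namely K = {((2 + cos(2πnt))·cos(2πmt), (2 + cos(2πnt))·sin(2πmt), sin(2πnt)) : t ∈ ℝ}. Then for any basepoint x₀ ∈ ℝ³ \ K (e.g. the origin), the fundamental group of ℝ³ \ K based at x₀ is isomorphic to the presented group G_{m,n} = ⟨a, b | aᵐ = bⁿ⟩. -/
open Real

/-- The `(m, n)` torus knot in `ℝ³`, lying on the torus of points at distance 1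
from the circle of radius 2 in the xy-plane. -/
def torusKnot (m n : ℕ) : Set (ℝ × ℝ × ℝ) :=
  {p | ∃ t : ℝ,
    p = ((2 + cos (2 * π * n * t)) * cos (2 * π * m * t),
         (2 + cos (2 * π * n * t)) * sin (2 * π * m * t),
         sin (2 * π * n * t))}

/-- The presented group `G_{m,n} = ⟨a, b | aᵐ = bⁿ⟩`, where `a` corresponds to
`true` and `b` to `false`. -/
abbrev TorusKnotGroup (m n : ℕ) : Type :=
  PresentedGroup ({FreeGroup.of true ^ m * (FreeGroup.of false ^ n)⁻¹} : Set (FreeGroup Bool))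

open scoped unitInterval in
/-- Given functions `k i : B → G` on an open cover `U i` whose quotients `k j * (k i)⁻¹` are locally
constant on the overlaps, `ν : I → G` is a parallel section along `γ` if each `k i (γ t) * ν t` is
locally constant. -/
def IsParallel {ι B G : Type*} [TopologicalSpace B] [Group G] (U : ι → Set B) (k : ι → B → G)
    (γ : I → B) (ν : I → G) : Prop :=
  ∀ t, ∃ i, γ t ∈ U i ∧ ∀ᶠ s in nhds t, k i (γ s) * ν s = k i (γ t) * ν t

section Monodromy

open Topology unitInterval

variable {ι B G : Type*} [TopologicalSpace B] [Group G] {U : ι → Set B} {k : ι → B → G}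

theorem IsParallel.mul_right {γ : I → B} {ν : I → G} (h : IsParallel U k γ ν) (g : G) :
    IsParallel U k γ (fun t => ν t * g) := fun t => by
  obtain ⟨i, hi, h⟩ := h t
  exact ⟨i, hi, h.mono fun s hs => by rw [← mul_assoc, ← mul_assoc, hs]⟩

variable [TopologicalSpace G] [DiscreteTopology G]

/-- The principal `G`-bundle with transition functions `k j * (k i)⁻¹`. -/
noncomputable def cocycleBundle (hU : ∀ i, IsOpen (U i)) (hc : ∀ x, ∃ i, x ∈ U i)
    (hk : ∀ i j, ∀ x ∈ U i ∩ U j, ∀ᶠ y in 𝓝 x, k j y * (k i y)⁻¹ = k j x * (k i x)⁻¹) :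
    FiberBundleCore ι B G where
  baseSet := U
  isOpen_baseSet := hU
  indexAt x := (hc x).choose
  mem_baseSet_at x := (hc x).choose_spec
  coordChange i j x v := k j x * (k i x)⁻¹ * v
  coordChange_self i x _ v := by simp
  continuousOn_coordChange i j := by
    rintro ⟨x, v⟩ ⟨hx, -⟩
    refine ContinuousAt.continuousWithinAt ?_
    have h1 : ContinuousAt (fun y => k j y * (k i y)⁻¹) x :=
      continuousAt_const.congr (f := fun _ => k j x * (k i x)⁻¹)
        ((hk i j x hx).mono fun y hy => hy.symm)
    exact ContinuousAt.mul (f := fun p : B × G => k j p.1 * (k i p.1)⁻¹) (g := fun p => p.2)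
      (ContinuousAt.comp (f := Prod.fst) (x := (x, v)) h1 continuousAt_fst) continuousAt_snd
  coordChange_comp i j l x _ v := by group

variable (hU : ∀ i, IsOpen (U i)) (hc : ∀ x, ∃ i, x ∈ U i)
    (hk : ∀ i j, ∀ x ∈ U i ∩ U j, ∀ᶠ y in 𝓝 x, k j y * (k i y)⁻¹ = k j x * (k i x)⁻¹)

/-- The point of the bundle over `x` with coordinate `k i x * g` in every chart `i`. -/
noncomputable def cocyclePoint (x : B) (g : G) : (cocycleBundle hU hc hk).TotalSpace :=
  ⟨x, (k (hc x).choose x * g : G)⟩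

/-- The chart-independent coordinate of a point of the bundle. -/
noncomputable def cocycleCoord (e : (cocycleBundle hU hc hk).TotalSpace) : G :=
  (k (hc e.1).choose e.1)⁻¹ * (show G from e.2)

@[simp] theorem cocycleCoord_point (x : B) (g : G) :
    cocycleCoord hU hc hk (cocyclePoint hU hc hk x g) = g := by
  simp [cocycleCoord, cocyclePoint]

@[simp] theorem cocyclePoint_coord (e : (cocycleBundle hU hc hk).TotalSpace) :
    cocyclePoint hU hc hk e.1 (cocycleCoord hU hc hk e) = e := by
  obtain ⟨x, v⟩ := e
  exact congrArg (Bundle.TotalSpace.mk x) (mul_inv_cancel_left (G := G) _ _)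

theorem localTriv_cocyclePoint (i : ι) (x : B) (g : G) :
    (cocycleBundle hU hc hk).localTriv i (cocyclePoint hU hc hk x g) = (x, k i x * g) := by
  refine Prod.ext rfl ?_
  change k i x * (k (hc x).choose x)⁻¹ * (k (hc x).choose x * g) = _
  group

theorem continuous_cocyclePoint_iff {γ : I → B} (hγ : Continuous γ) {ν : I → G} :
    Continuous (fun t => cocyclePoint hU hc hk (γ t) (ν t)) ↔ IsParallel U k γ ν := by
  have key : ∀ t i, γ t ∈ U i →
      (ContinuousAt (fun t => cocyclePoint hU hc hk (γ t) (ν t)) t ↔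
        ∀ᶠ s in nhds t, k i (γ s) * ν s = k i (γ t) * ν t) := by
    intro t i hi
    rw [((cocycleBundle hU hc hk).localTriv i).toOpenPartialHomeomorph
      |>.continuousAt_iff_continuousAt_comp_left (f := fun t => cocyclePoint hU hc hk (γ t) (ν t))]
    · have : ((cocycleBundle hU hc hk).localTriv i).toOpenPartialHomeomorph ∘
          (fun t => cocyclePoint hU hc hk (γ t) (ν t)) = fun t => (γ t, k i (γ t) * ν t) :=
        funext fun s => localTriv_cocyclePoint ..
      rw [this, ← Filter.tendsto_pure, ← nhds_discrete]
      exact ⟨fun h => continuous_snd.continuousAt.comp h, fun h => hγ.continuousAt.prodMk h⟩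
    · exact (hγ.continuousAt.preimage_mem_nhds ((hU i).mem_nhds hi))
  rw [continuous_iff_continuousAt]
  refine forall_congr' fun t => ⟨fun h => ?_, fun ⟨i, hi, h⟩ => (key t i hi).2 h⟩
  obtain ⟨i, hi⟩ := hc (γ t)
  exact ⟨i, hi, (key t i hi).1 h⟩

theorem isCoveringMap_cocycleBundle : IsCoveringMap (cocycleBundle hU hc hk).proj :=
  FiberBundle.isCoveringMap (F := G) (E := (cocycleBundle hU hc hk).Fiber)

theorem monodromy_cocyclePoint {x y : B} (γ : Path x y) {ν : I → G} (hν : IsParallel U k γ ν) :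
    (isCoveringMap_cocycleBundle hU hc hk).monodromy (.mk γ) ⟨cocyclePoint hU hc hk x (ν 0), rfl⟩ =
      ⟨cocyclePoint hU hc hk y (ν 1), rfl⟩ := by
  refine IsCoveringMap.monodromy_eq_of_map_eq _ (.mk
    { toFun := fun t => cocyclePoint hU hc hk (γ t) (ν t)
      continuous_toFun := (continuous_cocyclePoint_iff hU hc hk γ.continuous).2 hν
      source' := by simp
      target' := by simp }) ?_
  rfl

include hU hc hk in
theorem exists_isParallel {x y : B} (γ : Path x y) : ∃ ν, ν 0 = 1 ∧ IsParallel U k γ ν := by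
  have cov := isCoveringMap_cocycleBundle hU hc hk
  let Γ := cov.liftPath γ (cocyclePoint hU hc hk x 1) γ.source
  have h1 : ∀ t, (Γ t).1 = γ t := fun t => congr_fun (cov.liftPath_lifts γ _ γ.source) t
  have h0 : Γ 0 = cocyclePoint hU hc hk x 1 := cov.liftPath_zero γ _ γ.source
  refine ⟨fun t => cocycleCoord hU hc hk (Γ t), ?_, ?_⟩
  · simp only [h0, cocycleCoord_point]
  · rw [← continuous_cocyclePoint_iff hU hc hk γ.continuous]
    simp_rw [← h1, cocyclePoint_coord]
    exact Γ.continuous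

end Monodromy

open Topology in
theorem exists_monodromy {ι B G : Type*} [TopologicalSpace B] [Group G] {U : ι → Set B}
    {k : ι → B → G} (hU : ∀ i, IsOpen (U i)) (hc : ∀ x, ∃ i, x ∈ U i)
    (hk : ∀ i j, ∀ x ∈ U i ∩ U j, ∀ᶠ y in 𝓝 x, k j y * (k i y)⁻¹ = k j x * (k i x)⁻¹) (x₀ : B) :
    ∃ M : FundamentalGroup B x₀ →* G, ∀ (γ : Path x₀ x₀) (ν : unitInterval → G),
      IsParallel U k γ ν → M (.fromPath (.mk γ)) = ν 1 * (ν 0)⁻¹ := by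
  let _ : TopologicalSpace G := ⊥
  have : DiscreteTopology G := ⟨rfl⟩
  have cov := isCoveringMap_cocycleBundle hU hc hk
  let M (γ : Path.Homotopic.Quotient x₀ x₀) : G :=
    cocycleCoord hU hc hk (cov.monodromy γ ⟨cocyclePoint hU hc hk x₀ 1, rfl⟩).1
  have hM (γ : Path x₀ x₀) (ν : unitInterval → G) (hν : IsParallel U k γ ν) :
      M (.mk γ) = ν 1 * (ν 0)⁻¹ := by
    have := monodromy_cocyclePoint hU hc hk γ (hν.mul_right (ν 0)⁻¹)
    simp only [mul_inv_cancel] at this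
    simp [M, this]
  have hM' (γ : Path.Homotopic.Quotient x₀ x₀) (g : G) :
      cov.monodromy γ ⟨cocyclePoint hU hc hk x₀ g, rfl⟩ =
        ⟨cocyclePoint hU hc hk x₀ (M γ * g), rfl⟩ := by
    induction γ using Path.Homotopic.Quotient.ind with | _ γ
    obtain ⟨ν, h0, hν⟩ := exists_isParallel hU hc hk γ
    have := monodromy_cocyclePoint hU hc hk γ (hν.mul_right g)
    simp only [h0, one_mul] at this
    rw [this, hM γ ν hν, h0, inv_one, mul_one]
  refine ⟨⟨⟨M, ?_⟩, fun p q => ?_⟩, hM⟩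
  · change cocycleCoord hU hc hk (cov.monodromy (.refl x₀) _).1 = 1
    simp [cov.monodromy_refl]
  · change cocycleCoord hU hc hk (cov.monodromy (q.trans p) _).1 = M p * M q
    rw [cov.monodromy_trans_apply, hM', mul_one, hM', cocycleCoord_point]

section LoopClass

variable {X Y : Type*} [TopologicalSpace X] [TopologicalSpace Y] {x₀ : X}

/-- The class of a loop in the fundamental group. -/
def loopClass (γ : Path x₀ x₀) : FundamentalGroup X x₀ := .fromPath (.mk γ)

theorem loopClass_trans (γ γ' : Path x₀ x₀) :
    loopClass (γ.trans γ') = loopClass γ' * loopClass γ := rfl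

theorem loopClass_refl : loopClass (Path.refl x₀) = 1 := rfl

theorem loopClass_eq_iff {γ γ' : Path x₀ x₀} :
    loopClass γ = loopClass γ' ↔ γ.Homotopic γ' := Path.Homotopic.Quotient.eq

theorem loopClass_surjective : Function.Surjective (loopClass (x₀ := x₀)) := fun p => by
  obtain ⟨γ, rfl⟩ := Path.Homotopic.Quotient.mk_surjective p
  exact ⟨γ, rfl⟩

/-- If two open sets and their intersection are path connected, then a subgroup of the fundamental
group containing the loops in either open set contains the loops in their union. -/
theorem loopClass_mem_of_range_subset_union [PathConnectedSpace X] {S T : Set X}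
    (hS : IsOpen S) (hT : IsOpen T) (hS' : IsPathConnected S) (hT' : IsPathConnected T) (hST : IsPathConnected (S ∩ T))
    (hx₀ : x₀ ∈ S ∩ T) (H : Subgroup (FundamentalGroup X x₀))
    (HS : ∀ γ : Path x₀ x₀, Set.range γ ⊆ S → loopClass γ ∈ H)
    (HT : ∀ γ : Path x₀ x₀, Set.range γ ⊆ T → loopClass γ ∈ H)
    (γ : Path x₀ x₀) (hγ : Set.range γ ⊆ S ∪ T) : loopClass γ ∈ H := by
  have hc : ∀ x, ∃ c : Path x₀ x, (x ∈ S → Set.range c ⊆ S) ∧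
      (x ∈ T → Set.range c ⊆ T) := by
    intro x
    by_cases h1 : x ∈ S <;> by_cases h2 : x ∈ T
    · have h := hST.joinedIn x₀ hx₀ x ⟨h1, h2⟩
      exact ⟨h.somePath, fun _ => Set.range_subset_iff.2 fun t => (h.somePath_mem t).1,
        fun _ => Set.range_subset_iff.2 fun t => (h.somePath_mem t).2⟩
    · have h := hS'.joinedIn x₀ hx₀.1 x h1
      exact ⟨h.somePath, fun _ => Set.range_subset_iff.2 h.somePath_mem, fun h => (h2 h).elim⟩
    · have h := hT'.joinedIn x₀ hx₀.2 x h2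
      exact ⟨h.somePath, fun h => (h1 h).elim, fun _ => Set.range_subset_iff.2 h.somePath_mem⟩
    · exact ⟨PathConnectedSpace.somePath x₀ x, fun h => (h1 h).elim, fun h => (h2 h).elim⟩
  choose c hcS hcT using hc
  let L {x y : X} (γ : Path x y) : FundamentalGroup X x₀ :=
    loopClass (((c x).trans γ).trans (c y).symm)
  have L_trans {x y z : X} (γ : Path x y) (γ' : Path y z) : L (γ.trans γ') = L γ' * L γ := by
    change Path.Homotopic.Quotient.mk _ = Path.Homotopic.Quotient.trans (.mk _) (.mk _)
    simp only [Path.Homotopic.Quotient.mk_trans, Path.Homotopic.Quotient.mk_symm,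
      Path.Homotopic.Quotient.trans_assoc]
    congr 2
    rw [← Path.Homotopic.Quotient.trans_assoc (Path.Homotopic.Quotient.symm _),
      Path.Homotopic.Quotient.symm_trans, Path.Homotopic.Quotient.refl_trans]
  have L_cast {x y x' y' : X} (γ : Path x y) (hx : x' = x) (hy : y' = y) :
      L (γ.cast hx hy) = L γ := by subst hx hy; rfl
  have L_congr {x y : X} {γ γ' : Path x y} (h : γ.Homotopic γ') : L γ = L γ' := by
    refine loopClass_eq_iff.2 (Path.Homotopic.hcomp (Path.Homotopic.hcomp (.refl _) h) (.refl _))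
  have L_mem {x y : X} (γ : Path x y) (h : Set.range γ ⊆ S ∨ Set.range γ ⊆ T) : L γ ∈ H := by
    rcases h with h | h
    · have hx : x ∈ S := h γ.source_mem_range
      have hy : y ∈ S := h γ.target_mem_range
      refine HS _ ?_
      simp [Path.trans_range, Path.symm_range, hcS x hx, hcS y hy, h]
    · have hx : x ∈ T := h γ.source_mem_range
      have hy : y ∈ T := h γ.target_mem_range
      refine HT _ ?_
      simp [Path.trans_range, Path.symm_range, hcT x hx, hcT y hy, h]
  obtain ⟨t, t0, t_mono, ⟨N, hN⟩, ht⟩ := exists_monotone_Icc_subset_open_cover_unitInterval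
    (c := fun b : Bool => γ ⁻¹' (if b then S else T))
    (by rintro (_ | _); exacts [hT.preimage γ.continuous, hS.preimage γ.continuous])
    (fun s _ => (hγ ⟨s, rfl⟩).elim (fun h => Set.mem_iUnion.2 ⟨true, h⟩)
      fun h => Set.mem_iUnion.2 ⟨false, h⟩)
  have key (k : ℕ) : L (γ.subpath 0 (t k)) ∈ H := by
    induction k with
    | zero =>
      refine L_mem _ (.inl ?_)
      rw [t0, Path.subpath_self]
      simpa using hx₀.1
    | succ k ih =>
      rw [← L_congr ⟨Path.Homotopy.subpathTransSubpath γ 0 (t k) (t (k + 1))⟩, L_trans]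
      refine H.mul_mem (L_mem _ ?_) ih
      rw [Path.range_subpath_of_le _ _ _ (t_mono k.le_succ)]
      obtain ⟨b, hb⟩ := ht k
      cases b
      · exact .inr (Set.image_subset_iff.2 hb)
      · exact .inl (Set.image_subset_iff.2 hb)
  have h1 : L γ ∈ H := by
    have := key N
    rwa [hN N le_rfl, Path.subpath_zero_one, L_cast] at this
  have h2 : L γ = (loopClass (c x₀))⁻¹ * (loopClass γ * loopClass (c x₀)) := rfl
  have h3 := HS _ (hcS x₀ hx₀.1)
  rw [h2] at h1
  exact (Subgroup.mul_mem_cancel_right _ h3).1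
    ((Subgroup.mul_mem_cancel_left _ (H.inv_mem h3)).1 h1)

/-- Paths with the same endpoints that lift to paths with the same endpoints in a simply connected
space are homotopic. -/
theorem homotopic_of_lift {D : Type*} [TopologicalSpace D] [SimplyConnectedSpace D] {f : D → X}
    (hf : Continuous f) {x y : X} {γ γ' : Path x y} {d e : D} (δ δ' : Path d e)
    (h : ∀ t, f (δ t) = γ t) (h' : ∀ t, f (δ' t) = γ' t) : γ.Homotopic γ' := by
  obtain rfl : f d = x := by simpa using h 0
  obtain rfl : f e = y := by simpa using h 1
  convert! (SimplyConnectedSpace.paths_homotopic δ δ').map ⟨f, hf⟩ using 1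
  · ext t; exact (h t).symm
  · ext t; exact (h' t).symm

end LoopClass

section Angle

open ComplexConjugate

/-- The point of the unit circle at angle `2πs`. -/
noncomputable def cis (s : ℝ) : ℂ := ⟨cos (2 * π * s), sin (2 * π * s)⟩

theorem cis_eq_exp (s : ℝ) : cis s = Complex.exp ((2 * π * s : ℝ) * Complex.I) := by
  rw [Complex.exp_mul_I, ← Complex.ofReal_cos, ← Complex.ofReal_sin]
  apply Complex.ext <;> simp [cis, -Complex.ofReal_cos, -Complex.ofReal_sin]

@[simp] theorem cis_re (s : ℝ) : (cis s).re = cos (2 * π * s) := rfl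

@[simp] theorem cis_im (s : ℝ) : (cis s).im = sin (2 * π * s) := rfl

@[fun_prop] theorem continuous_cis : Continuous cis := by
  simp only [funext cis_eq_exp]; fun_prop

@[simp] theorem norm_cis (s : ℝ) : ‖cis s‖ = 1 := by
  rw [cis_eq_exp, Complex.norm_exp_ofReal_mul_I]

@[simp] theorem cis_ne_zero (s : ℝ) : cis s ≠ 0 := by rw [← norm_ne_zero_iff]; simp

theorem cis_add (s t : ℝ) : cis (s + t) = cis s * cis t := by
  simp only [cis_eq_exp, ← Complex.exp_add]; congr 1; push_cast; ring

theorem cis_nat_mul (n : ℕ) (s : ℝ) : cis (n * s) = cis s ^ n := by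
  simp only [cis_eq_exp, ← Complex.exp_nat_mul]; congr 1; push_cast; ring

theorem cis_neg (s : ℝ) : cis (-s) = conj (cis s) := by
  apply Complex.ext <;> simp

theorem cis_sub (s t : ℝ) : cis (s - t) = cis s * conj (cis t) := by
  rw [sub_eq_add_neg, cis_add, cis_neg]

theorem cis_eq_cis_iff {s t : ℝ} : cis s = cis t ↔ ∃ k : ℤ, s = t + k := by
  rw [cis_eq_exp, cis_eq_exp, Complex.exp_eq_exp_iff_exists_int]
  refine exists_congr fun k => ?_
  have : (2 * π * t : ℝ) * Complex.I + k * (2 * π * Complex.I) =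
    (2 * π * (t + k) : ℝ) * Complex.I := by push_cast; ring
  rw [this, mul_left_inj' Complex.I_ne_zero, Complex.ofReal_inj,
    mul_right_inj' (by positivity)]

@[simp] theorem cis_zero : cis 0 = 1 := by simp [cis_eq_exp]

theorem cis_add_int (s : ℝ) (k : ℤ) : cis (s + k) = cis s := cis_eq_cis_iff.2 ⟨k, rfl⟩

theorem neg_cis_mem_slitPlane {s : ℝ} : -cis s ∈ Complex.slitPlane ↔ ∀ k : ℤ, s ≠ k := by
  have h : cis s = cis 0 ↔ ∃ k : ℤ, s = k := by rw [cis_eq_cis_iff]; simp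
  rw [← not_exists, ← h, cis_zero, Complex.mem_slitPlane_iff, Complex.ext_iff]
  have h1 := cos_sq_add_sin_sq (2 * π * s)
  simp only [Complex.neg_re, Complex.neg_im, cis_re, cis_im, Complex.one_re, Complex.one_im]
  constructor
  · rintro h ⟨h2, h3⟩
    rcases h with h | h
    · linarith
    · simp [h3] at h
  · intro h
    by_contra! h2
    have h3 : sin (2 * π * s) = 0 := neg_eq_zero.1 h2.2
    refine h ⟨?_, h3⟩
    rw [h3] at h1
    nlinarith

/-- `s` is a polar angle of `z`, in units of full turns. -/
def IsAngle (z : ℂ) (s : ℝ) : Prop := z = ‖z‖ * cis s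

theorem isAngle_mul_cis {r : ℝ} (hr : 0 ≤ r) (s : ℝ) : IsAngle (r * cis s) s := by
  simp [IsAngle, abs_of_nonneg hr]

theorem isAngle_arg (z : ℂ) : IsAngle z (z.arg / (2 * π)) := by
  rw [IsAngle, cis_eq_exp, mul_div_cancel₀ _ (by positivity), Complex.norm_mul_exp_arg_mul_I]

theorem IsAngle.add_int {z : ℂ} {s : ℝ} (h : IsAngle z s) (k : ℤ) : IsAngle z (s + k) := by
  rwa [IsAngle, cis_add_int]

theorem IsAngle.mul {z w : ℂ} {s t : ℝ} (hz : IsAngle z s) (hw : IsAngle w t) :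
    IsAngle (z * w) (s + t) := by
  rw [IsAngle, cis_add]
  nth_rw 1 [hz, hw]
  simp
  ring

theorem IsAngle.exists_int {z : ℂ} (hz : z ≠ 0) {s t : ℝ} (hs : IsAngle z s) (ht : IsAngle z t) :
    ∃ k : ℤ, s = t + k :=
  cis_eq_cis_iff.1 (mul_left_cancel₀ (Complex.ofReal_ne_zero.2 (norm_ne_zero_iff.2 hz))
    (hs.symm.trans ht))

open unitInterval in
theorem exists_isAngle_lift {f : I → ℂ} (hf : Continuous f) (h0 : ∀ t, f t ≠ 0) {s₀ : ℝ}
    (hs₀ : IsAngle (f 0) s₀) :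
    ∃ s : I → ℝ, Continuous s ∧ s 0 = s₀ ∧ ∀ t, IsAngle (f t) (s t) := by
  let γ : C(I, {z : ℂ // z ≠ 0}) := ⟨fun t => ⟨f t, h0 t⟩, by fun_prop⟩
  let e : ℂ := Real.log ‖f 0‖ + (2 * π * s₀ : ℝ) * Complex.I
  have he : γ 0 = ⟨_, e.exp_ne_zero⟩ := by
    refine Subtype.ext ?_
    change f 0 = Complex.exp e
    rw [Complex.exp_add, ← cis_eq_exp, ← Complex.ofReal_exp,
      Real.exp_log (norm_pos_iff.2 (h0 0)), ← hs₀]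
  let Γ := Complex.isCoveringMap_exp.liftPath γ e he
  have hΓ (t : I) : Complex.exp (Γ t) = f t :=
    congr_arg Subtype.val (congr_fun (Complex.isCoveringMap_exp.liftPath_lifts γ e he) t)
  have hΓ0 : Γ 0 = e := Complex.isCoveringMap_exp.liftPath_zero γ e he
  refine ⟨fun t => (Γ t).im / (2 * π), by fun_prop, ?_, fun t => ?_⟩
  · simp only [hΓ0, e]
    simp
  · rw [IsAngle, cis_eq_exp, mul_div_cancel₀ _ (by positivity), ← hΓ, Complex.norm_exp,
      Complex.ofReal_exp, ← Complex.exp_add, Complex.re_add_im]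

open Topology in
theorem eventually_eq_of_exists_int {X : Type*} [TopologicalSpace X] {x : X} {u v : X → ℝ}
    (hu : ContinuousAt u x) (hv : ContinuousAt v x) (h : ∀ᶠ y in 𝓝 x, ∃ k : ℤ, u y = v y + k) :
    ∃ k : ℤ, ∀ᶠ y in 𝓝 x, u y = v y + k := by
  obtain ⟨k, hk⟩ := h.self_of_nhds
  have : ContinuousAt (fun y => u y - v y) x := hu.sub hv
  have h1 : ∀ᶠ y in 𝓝 x, |(u y - v y) - (u x - v x)| < 1 := by
    have := Metric.tendsto_nhds.1 this 1 one_pos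
    exact this
  refine ⟨k, (h.and h1).mono ?_⟩
  rintro y ⟨⟨l, hl⟩, hy⟩
  rw [hl, hk] at hy
  have : |((l - k : ℤ) : ℝ)| < 1 := by push_cast; convert hy using 2; ring
  rw [← Int.cast_abs] at this
  have h2 : l - k = 0 := Int.abs_lt_one_iff.1 (by exact_mod_cast this)
  rw [hl, sub_eq_zero.1 h2]

/-- A polar angle function that is continuous where `z / c` is not a negative real. -/
noncomputable def angleNear (c z : ℂ) : ℝ := c.arg / (2 * π) + (z / c).arg / (2 * π)

theorem isAngle_angleNear {c : ℂ} (hc : c ≠ 0) (z : ℂ) : IsAngle z (angleNear c z) := by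
  have := (isAngle_arg c).mul (isAngle_arg (z / c))
  rwa [mul_div_cancel₀ _ hc] at this

theorem continuousAt_angleNear {c z : ℂ} (h : z / c ∈ Complex.slitPlane) :
    ContinuousAt (angleNear c) z := by
  refine continuousAt_const.add (ContinuousAt.div_const ?_ _)
  exact (Complex.continuousAt_arg h).comp (f := fun z => z / c)
    (continuous_id.div_const c).continuousAt

end Angle

section DeckTransformation

variable {X D Λ : Type*} [TopologicalSpace X] [TopologicalSpace D] [SimplyConnectedSpace D]
  [AddCommGroup Λ]

theorem exists_deckHom {f : D → X} (hf : Continuous f) {τ : Λ → D → D}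
    (hτ : ∀ a, Continuous (τ a)) (hadd : ∀ a b d, τ (a + b) d = τ a (τ b d))
    (hfτ : ∀ a d, f (τ a d) = f d) {d₀ : D} {x₀ : X} (h₀ : f d₀ = x₀) :
    ∃ Φ : Multiplicative Λ →* FundamentalGroup X x₀, ∀ (γ : Path x₀ x₀) (a : Λ)
      (δ : Path d₀ (τ a d₀)), (∀ t, f (δ t) = γ t) → loopClass γ = Φ (.ofAdd a) := by
  subst h₀
  let p (a : Λ) : Path d₀ (τ a d₀) := PathConnectedSpace.somePath _ _
  let q (a : Λ) : Path (f d₀) (f d₀) := ((p a).map hf).cast rfl (hfτ a d₀).symm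
  have key (γ : Path (f d₀) (f d₀)) (a : Λ) (δ : Path d₀ (τ a d₀)) (h : ∀ t, f (δ t) = γ t) :
      loopClass γ = loopClass (q a) :=
    loopClass_eq_iff.2 (homotopic_of_lift hf δ (p a) h fun t => rfl)
  have q_add (a b : Λ) : loopClass (q (a + b)) = loopClass (q b) * loopClass (q a) := by
    rw [← loopClass_trans]
    refine (key _ (a + b) (((p a).trans ((p b).map (hτ a))).cast rfl (hadd a b d₀)) ?_).symm
    intro t
    simp only [Path.cast_coe, Path.trans_apply]
    split_ifs
    · rfl
    · exact hfτ a _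
  refine ⟨MonoidHom.mk' (fun a => loopClass (q a.toAdd)) fun a b => ?_, key⟩
  rw [mul_comm, toAdd_mul, q_add]

end DeckTransformation

/-- A subset of a topological vector space that retracts along segments to a convex subset is
contractible. -/
theorem contractibleSpace_of_segment_subset {E : Type*} [AddCommGroup E] [Module ℝ E]
    [TopologicalSpace E] [IsTopologicalAddGroup E] [ContinuousSMul ℝ E] {S T : Set E}
    (hT : Convex ℝ T) (hT' : T.Nonempty) (hTS : T ⊆ S) {r : E → E} (hr : ContinuousOn r S)
    (hrT : ∀ x ∈ S, r x ∈ T) (hrS : ∀ x ∈ S, segment ℝ x (r x) ⊆ S) : ContractibleSpace S := by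
  obtain ⟨c, hc⟩ := hT'
  have hr' : Continuous fun x : S => r x := hr.domRestrict
  rw [contractible_iff_id_nullhomotopic]
  refine ⟨⟨c, hTS hc⟩, ContinuousMap.Homotopic.trans
    (g := ⟨fun x => ⟨r x, hTS (hrT x x.2)⟩, hr'.subtype_mk _⟩) ⟨?_⟩ ⟨?_⟩⟩
  · refine ⟨⟨fun p => ⟨AffineMap.lineMap (p.2 : E) (r p.2) (p.1 : ℝ), hrS p.2 p.2.2 ?_⟩,
      Continuous.subtype_mk ?_ _⟩, fun x => ?_, fun x => ?_⟩
    · rw [segment_eq_image_lineMap]; exact ⟨p.1, p.1.2, rfl⟩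
    · simp only [AffineMap.lineMap_apply_module]
      exact ((by fun_prop : Continuous fun p : unitInterval × S => (1 - (p.1 : ℝ))).smul
        (by fun_prop)).add ((by fun_prop : Continuous fun p : unitInterval × S => (p.1 : ℝ)).smul
        (hr'.comp continuous_snd))
    · ext; simp
    · ext; simp
  · refine ⟨⟨fun p => ⟨AffineMap.lineMap (r p.2) c (p.1 : ℝ), hTS
      (hT.segment_subset (hrT p.2 p.2.2) hc ?_)⟩, Continuous.subtype_mk ?_ _⟩,
      fun x => ?_, fun x => ?_⟩
    · rw [segment_eq_image_lineMap]; exact ⟨p.1, p.1.2, rfl⟩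
    · simp only [AffineMap.lineMap_apply_module]
      exact ((by fun_prop : Continuous fun p : unitInterval × S => (1 - (p.1 : ℝ))).smul
        (hr'.comp continuous_snd)).add (by fun_prop)
    · ext; simp
    · ext; simp

section Coordinates

open ComplexConjugate

/-- The projection to the plane, as a complex number. -/
def planeCoord (p : ℝ × ℝ × ℝ) : ℂ := ⟨p.1, p.2.1⟩

/-- The coordinate relative to the circle of radius 2 in the half plane through `p`. -/
noncomputable def coreCoord (p : ℝ × ℝ × ℝ) : ℂ := ⟨‖planeCoord p‖ - 2, p.2.2⟩

/-- The point at angle `θ` around the axis with core coordinate `w`. -/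
noncomputable def revolve (w : ℂ) (θ : ℝ) : ℝ × ℝ × ℝ :=
  ((2 + w.re) * cos (2 * π * θ), (2 + w.re) * sin (2 * π * θ), w.im)

/-- The points that lie over the complement of the `(m, n)` torus knot in the punctured half planes,
radially with respect to the core circle. -/
def offKnotCone (m n : ℕ) : Set (ℝ × ℝ × ℝ) :=
  {p | -(planeCoord p ^ n * conj (coreCoord p) ^ m) ∈ Complex.slitPlane}

theorem continuous_complexMk {X : Type*} [TopologicalSpace X] {f g : X → ℝ} (hf : Continuous f)
    (hg : Continuous g) : Continuous fun x => (⟨f x, g x⟩ : ℂ) :=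
  Complex.equivRealProdCLM.symm.continuous.comp (hf.prodMk hg)

@[fun_prop] theorem continuous_planeCoord : Continuous planeCoord :=
  continuous_complexMk (by fun_prop) (by fun_prop)

@[fun_prop] theorem continuous_coreCoord : Continuous coreCoord :=
  continuous_complexMk (by fun_prop) (by fun_prop)

theorem continuous_revolve : Continuous fun q : ℂ × ℝ => revolve q.1 q.2 := by
  unfold revolve; fun_prop

theorem isOpen_offKnotCone (m n : ℕ) : IsOpen (offKnotCone m n) :=
  Complex.isOpen_slitPlane.preimage (by fun_prop)

theorem planeCoord_revolve (w : ℂ) (θ : ℝ) :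
    planeCoord (revolve w θ) = (2 + w.re : ℝ) * cis θ := by
  apply Complex.ext <;> simp [planeCoord, revolve]

theorem norm_planeCoord_revolve {w : ℂ} (hw : 0 ≤ 2 + w.re) (θ : ℝ) :
    ‖planeCoord (revolve w θ)‖ = 2 + w.re := by
  rw [planeCoord_revolve, norm_mul, norm_cis, mul_one, Complex.norm_real, norm_of_nonneg hw]

theorem isAngle_planeCoord_revolve {w : ℂ} (hw : 0 ≤ 2 + w.re) (θ : ℝ) :
    IsAngle (planeCoord (revolve w θ)) θ := by
  rw [planeCoord_revolve]; exact isAngle_mul_cis hw θ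

theorem coreCoord_revolve {w : ℂ} (hw : 0 ≤ 2 + w.re) (θ : ℝ) :
    coreCoord (revolve w θ) = w := by
  apply Complex.ext
  · simp [coreCoord, norm_planeCoord_revolve hw]
  · rfl

theorem two_add_re_coreCoord (p : ℝ × ℝ × ℝ) : 2 + (coreCoord p).re = ‖planeCoord p‖ := by
  simp [coreCoord]

theorem revolve_coreCoord {p : ℝ × ℝ × ℝ} {θ : ℝ} (h : IsAngle (planeCoord p) θ) :
    revolve (coreCoord p) θ = p := by
  have h1 := congr_arg Complex.re h
  have h2 := congr_arg Complex.im h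
  rw [Complex.re_ofReal_mul, cis_re] at h1
  rw [Complex.im_ofReal_mul, cis_im] at h2
  rw [revolve, two_add_re_coreCoord, ← h1, ← h2]
  rfl

theorem revolve_add_int (w : ℂ) (θ : ℝ) (k : ℤ) : revolve w (θ + k) = revolve w θ := by
  have h := cis_add_int θ k
  have h1 := congr_arg Complex.re h
  have h2 := congr_arg Complex.im h
  simp only [cis_re, cis_im] at h1 h2
  rw [revolve, revolve, h1, h2]

theorem mem_torusKnot_iff {m n : ℕ} {p : ℝ × ℝ × ℝ} :
    p ∈ torusKnot m n ↔ ∃ t : ℝ, p = revolve (cis (n * t)) (m * t) := by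
  simp only [torusKnot, revolve, cis_re, cis_im, Set.mem_ofPred_eq, mul_assoc]

theorem two_add_cos_pos (x : ℝ) : 0 < 2 + cos x := by linarith [neg_one_le_cos x]

theorem mem_offKnotCone_iff_of_ne {m n : ℕ} {p : ℝ × ℝ × ℝ} {s s' : ℝ}
    (hs : IsAngle (planeCoord p) s) (hs' : IsAngle (coreCoord p) s')
    (h : planeCoord p ≠ 0) (h' : coreCoord p ≠ 0) :
    p ∈ offKnotCone m n ↔ ∀ k : ℤ, n * s - m * s' ≠ k := by
  have : -(planeCoord p ^ n * conj (coreCoord p) ^ m) =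
      (‖planeCoord p‖ ^ n * ‖coreCoord p‖ ^ m : ℝ) * -cis (n * s - m * s') := by
    nth_rw 1 [hs, hs']
    rw [cis_sub, cis_nat_mul, cis_nat_mul]
    simp
    ring
  rw [offKnotCone, Set.mem_ofPred_eq, this, ← neg_cis_mem_slitPlane,
    Complex.mem_slitPlane_iff, Complex.mem_slitPlane_iff, Complex.re_ofReal_mul,
    Complex.im_ofReal_mul]
  have : 0 < ‖planeCoord p‖ ^ n * ‖coreCoord p‖ ^ m := by
    have := norm_pos_iff.2 h; have := norm_pos_iff.2 h'; positivity
  rw [mul_pos_iff_of_pos_left this, mul_ne_zero_iff_left this.ne']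

theorem ne_zero_of_mem_offKnotCone {m n : ℕ} (hm : m ≠ 0) (hn : n ≠ 0) {p : ℝ × ℝ × ℝ}
    (h : p ∈ offKnotCone m n) : planeCoord p ≠ 0 ∧ coreCoord p ≠ 0 := by
  have := Complex.slitPlane_ne_zero h
  simpa [hm, hn] using this

theorem mem_offKnotCone_iff {m n : ℕ} (hm : m ≠ 0) (hn : n ≠ 0) {p : ℝ × ℝ × ℝ} {s s' : ℝ}
    (hs : IsAngle (planeCoord p) s) (hs' : IsAngle (coreCoord p) s') :
    p ∈ offKnotCone m n ↔
      planeCoord p ≠ 0 ∧ coreCoord p ≠ 0 ∧ ∀ k : ℤ, n * s - m * s' ≠ k :=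
  ⟨fun h => have h0 := ne_zero_of_mem_offKnotCone hm hn h
    ⟨h0.1, h0.2, (mem_offKnotCone_iff_of_ne hs hs' h0.1 h0.2).1 h⟩,
    fun h => (mem_offKnotCone_iff_of_ne hs hs' h.1 h.2.1).2 h.2.2⟩

theorem planeCoord_ne_zero_of_norm_coreCoord {p : ℝ × ℝ × ℝ} (h : ‖coreCoord p‖ < 2) :
    planeCoord p ≠ 0 := by
  intro h0
  have := (Complex.abs_re_le_norm (coreCoord p)).trans_lt h
  simp [coreCoord, h0] at this

theorem one_lt_norm_coreCoord {p : ℝ × ℝ × ℝ} (h : ‖planeCoord p‖ < 1) : 1 < ‖coreCoord p‖ := by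
  refine lt_of_lt_of_le ?_ (Complex.abs_re_le_norm (coreCoord p))
  rw [lt_abs]; right; simp only [coreCoord]; linarith

theorem notMem_torusKnot_iff {m n : ℕ} (hm : m ≠ 0) (hn : n ≠ 0) (hmn : Nat.gcd m n = 1)
    {p : ℝ × ℝ × ℝ} : p ∉ torusKnot m n ↔ ‖coreCoord p‖ ≠ 1 ∨ p ∈ offKnotCone m n := by
  rw [mem_torusKnot_iff]
  constructor
  · intro h
    by_contra! h1
    obtain ⟨h1, h2⟩ := h1
    refine h ?_
    have hw : coreCoord p ≠ 0 := by rw [← norm_ne_zero_iff, h1]; exact one_ne_zero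
    have hz : planeCoord p ≠ 0 := planeCoord_ne_zero_of_norm_coreCoord (by linarith)
    have hs := isAngle_arg (planeCoord p)
    have hs' := isAngle_arg (coreCoord p)
    set s := (planeCoord p).arg / (2 * π)
    set s' := (coreCoord p).arg / (2 * π)
    rw [mem_offKnotCone_iff_of_ne hs hs' hz hw] at h2
    push Not at h2
    obtain ⟨k, hk⟩ := h2
    have hb := Nat.gcd_eq_gcd_ab m n
    rw [hmn] at hb
    set a := Nat.gcdA m n
    set b := Nat.gcdB m n
    have hb' : (1 : ℝ) = m * a + n * b := by exact_mod_cast hb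
    refine ⟨a * s + b * s', ?_⟩
    have e1 : (m : ℝ) * (a * s + b * s') = s + ((-(b * k) : ℤ) : ℝ) := by
      push_cast; linear_combination (-s) * hb' - b * hk
    have e2 : (n : ℝ) * (a * s + b * s') = s' + ((a * k : ℤ) : ℝ) := by
      push_cast; linear_combination (-s') * hb' + a * hk
    rw [e1, e2, cis_add_int, revolve_add_int]
    have : cis s' = coreCoord p := by
      rw [hs', h1]; simp
    rw [this, revolve_coreCoord hs]
  · rintro h ⟨t, rfl⟩
    have h0 : 0 < 2 + (cis (n * t)).re := two_add_cos_pos _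
    have hs := isAngle_planeCoord_revolve h0.le (m * t)
    have hs' : IsAngle (coreCoord (revolve (cis (n * t)) (m * t))) (n * t) := by
      rw [coreCoord_revolve h0.le]; simp [IsAngle]
    rw [mem_offKnotCone_iff hm hn hs hs', coreCoord_revolve h0.le, norm_cis] at h
    refine h.elim (fun h => h rfl) fun h => h.2.2 0 ?_
    push_cast; ring

end Coordinates

section Regions

open Set ComplexConjugate

/-- The complement of the `(m, n)` torus knot. -/
abbrev KnotComplement (m n : ℕ) : Type := ((torusKnot m n)ᶜ : Set (ℝ × ℝ × ℝ))

/-- The open solid torus bounded by the knotted torus, thickened off the knot. -/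
def innerRegion (m n : ℕ) : Set (KnotComplement m n) :=
  {x | ‖coreCoord x‖ < 1 ∨ (x : ℝ × ℝ × ℝ) ∈ offKnotCone m n}

/-- The exterior of the knotted torus, thickened off the knot. -/
def outerRegion (m n : ℕ) : Set (KnotComplement m n) :=
  {x | 1 < ‖coreCoord x‖ ∨ (x : ℝ × ℝ × ℝ) ∈ offKnotCone m n}

/-- The complement of the axis. -/
def offAxis (m n : ℕ) : Set (KnotComplement m n) := {x | planeCoord x ≠ 0}

/-- A tube around the axis that avoids the torus. -/
def axisTube (m n : ℕ) : Set (KnotComplement m n) := {x | ‖planeCoord x‖ < 1}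

/-- The part of the cone over the complement of the knot in the torus. -/
def coneRegion (m n : ℕ) : Set (KnotComplement m n) := {x | (x : ℝ × ℝ × ℝ) ∈ offKnotCone m n}

variable {m n : ℕ}

theorem isOpen_innerRegion : IsOpen (innerRegion m n) :=
  (isOpen_lt (continuous_coreCoord.comp continuous_subtype_val).norm continuous_const).union
    ((isOpen_offKnotCone m n).preimage continuous_subtype_val)

theorem isOpen_outerRegion : IsOpen (outerRegion m n) :=
  (isOpen_lt continuous_const (continuous_coreCoord.comp continuous_subtype_val).norm).union
    ((isOpen_offKnotCone m n).preimage continuous_subtype_val)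

theorem isOpen_offAxis : IsOpen (offAxis m n) :=
  isOpen_ne_fun (by fun_prop) continuous_const

theorem isOpen_axisTube : IsOpen (axisTube m n) :=
  isOpen_lt (by fun_prop) continuous_const

theorem axisTube_subset_outerRegion : axisTube m n ⊆ outerRegion m n := fun _ hx =>
  .inl (one_lt_norm_coreCoord hx)

theorem inner_inter_outer : innerRegion m n ∩ outerRegion m n = coneRegion m n := by
  ext x
  constructor
  · intro h
    rcases h.1 with h1 | h1
    · rcases h.2 with h2 | h2
      exacts [(lt_asymm h1 h2).elim, h2]
    · exact h1
  · exact fun h => ⟨Or.inr h, Or.inr h⟩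

/-- The universal cover of `innerRegion`: core coordinate and angle around the axis. -/
def innerCover (m n : ℕ) : Set (ℂ × ℝ) :=
  {q | 0 < 2 + q.1.re ∧ (‖q.1‖ < 1 ∨ revolve q.1 q.2 ∈ offKnotCone m n)}

/-- The universal cover of `outerRegion ∩ offAxis`: the distance to the core circle and the angles
around the core circle and around the axis. -/
def outerCover (m n : ℕ) : Set (ℝ × ℝ × ℝ) :=
  {q | 0 < q.1 ∧ 0 < 2 + q.1 * cos (2 * π * q.2.1) ∧
    (1 < q.1 ∨ ∀ k : ℤ, n * q.2.2 - m * q.2.1 ≠ k)}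

/-- The part of `outerCover` over a sheet of the region `offKnotCone`. -/
def coneCover (m n : ℕ) : Set (ℝ × ℝ × ℝ) :=
  {q | 0 < q.1 ∧ 0 < 2 + q.1 * cos (2 * π * q.2.1) ∧
    0 < n * q.2.2 - m * q.2.1 ∧ n * q.2.2 - m * q.2.1 < 1}

/-- The point with given distance to the core circle and angles around the core circle and
around the axis. -/
noncomputable def toroidal (q : ℝ × ℝ × ℝ) : ℝ × ℝ × ℝ := revolve (q.1 * cis q.2.1) q.2.2

@[fun_prop] theorem continuous_toroidal : Continuous toroidal :=
  continuous_revolve.comp (f := fun q : ℝ × ℝ × ℝ => ((q.1 : ℂ) * cis q.2.1, q.2.2)) (by fun_prop)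

theorem coreCoord_toroidal {q : ℝ × ℝ × ℝ} (h : 0 ≤ 2 + q.1 * cos (2 * π * q.2.1)) :
    coreCoord (toroidal q) = q.1 * cis q.2.1 := coreCoord_revolve (by simpa using h) _

theorem norm_planeCoord_toroidal {q : ℝ × ℝ × ℝ} (h : 0 ≤ 2 + q.1 * cos (2 * π * q.2.1)) :
    ‖planeCoord (toroidal q)‖ = 2 + q.1 * cos (2 * π * q.2.1) := by
  have h' : 0 ≤ 2 + (q.1 * cis q.2.1 : ℂ).re := by simpa using h
  rw [toroidal, norm_planeCoord_revolve h']
  simp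

theorem isAngle_planeCoord_toroidal {q : ℝ × ℝ × ℝ} (h : 0 ≤ 2 + q.1 * cos (2 * π * q.2.1)) :
    IsAngle (planeCoord (toroidal q)) q.2.2 := isAngle_planeCoord_revolve (by simpa using h) _

theorem isAngle_coreCoord_toroidal {q : ℝ × ℝ × ℝ} (h0 : 0 ≤ q.1)
    (h : 0 ≤ 2 + q.1 * cos (2 * π * q.2.1)) : IsAngle (coreCoord (toroidal q)) q.2.1 := by
  rw [coreCoord_toroidal h]; exact isAngle_mul_cis h0 _

theorem norm_coreCoord_toroidal {q : ℝ × ℝ × ℝ} (h0 : 0 ≤ q.1)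
    (h : 0 ≤ 2 + q.1 * cos (2 * π * q.2.1)) : ‖coreCoord (toroidal q)‖ = q.1 := by
  rw [coreCoord_toroidal h]; simp [abs_of_nonneg h0]

theorem toroidal_eq {p : ℝ × ℝ × ℝ} {φ θ : ℝ} (hφ : IsAngle (coreCoord p) φ)
    (hθ : IsAngle (planeCoord p) θ) : toroidal (‖coreCoord p‖, φ, θ) = p := by
  rw [toroidal]
  dsimp only
  rw [← hφ, revolve_coreCoord hθ]

theorem two_add_mul_cos_eq {p : ℝ × ℝ × ℝ} {φ : ℝ} (hφ : IsAngle (coreCoord p) φ) :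
    2 + ‖coreCoord p‖ * cos (2 * π * φ) = ‖planeCoord p‖ := by
  rw [← two_add_re_coreCoord]
  nth_rw 2 [hφ]
  simp

theorem toroidal_mem_offKnotCone_iff (hm : m ≠ 0) (hn : n ≠ 0) {q : ℝ × ℝ × ℝ} (h0 : 0 < q.1)
    (h : 0 < 2 + q.1 * cos (2 * π * q.2.1)) :
    toroidal q ∈ offKnotCone m n ↔ ∀ k : ℤ, n * q.2.2 - m * q.2.1 ≠ k := by
  rw [mem_offKnotCone_iff hm hn (isAngle_planeCoord_toroidal h.le)
    (isAngle_coreCoord_toroidal h0.le h.le), ← norm_ne_zero_iff (a := coreCoord _),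
    ← norm_ne_zero_iff (a := planeCoord _), norm_planeCoord_toroidal h.le,
    norm_coreCoord_toroidal h0.le h.le]
  simp [h.ne', h0.ne']

theorem two_add_mul_cos_pos_of_lt {ρ x : ℝ} (h0 : 0 ≤ ρ) (h : ρ < 2) : 0 < 2 + ρ * cos x := by
  nlinarith [neg_one_le_cos x]

theorem convexComb_lt {a b x y c : ℝ} (ha : 0 ≤ a) (hb : 0 ≤ b) (hab : a + b = 1) (hx : c < x)
    (hy : c < y) : c < a * x + b * y :=
  convex_Ioi c hx hy ha hb hab

theorem contractibleSpace_outerCover : ContractibleSpace (outerCover m n) := by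
  refine contractibleSpace_of_segment_subset (T := {q | q.1 = 3 / 2}) (r := fun q => (3 / 2, q.2))
    ?_ ⟨(3 / 2, 0), rfl⟩ ?_ (by fun_prop) (fun _ _ => rfl) ?_
  · exact convex_hyperplane (LinearMap.isLinear (LinearMap.fst ℝ ℝ (ℝ × ℝ))) _
  · rintro ⟨ρ, φ, θ⟩ (rfl : ρ = 3 / 2)
    exact ⟨by norm_num, two_add_mul_cos_pos_of_lt (by norm_num) (by norm_num), .inl (by norm_num)⟩
  · rintro ⟨ρ, φ, θ⟩ ⟨h1, h2, h3⟩ _ ⟨a, b, ha, hb, hab, rfl⟩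
    dsimp only at h1 h2 h3
    have h4 := two_add_mul_cos_pos_of_lt (ρ := 3 / 2) (x := 2 * π * φ) (by norm_num) (by norm_num)
    have e : a • (ρ, φ, θ) + b • ((3 / 2 : ℝ), φ, θ) = (a * ρ + b * (3 / 2), φ, θ) := by
      simp [← add_mul, hab]
    rw [e]
    refine ⟨convexComb_lt ha hb hab h1 (by norm_num), ?_,
      h3.imp_left fun h => convexComb_lt ha hb hab h (by norm_num)⟩
    have := convexComb_lt ha hb hab h2 h4
    dsimp only
    linear_combination this + 2 * hab

theorem contractibleSpace_coneCover (hn : n ≠ 0) : ContractibleSpace (coneCover m n) := by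
  have hn' : (n : ℝ) ≠ 0 := Nat.cast_ne_zero.2 hn
  refine contractibleSpace_of_segment_subset (r := fun q => (3 / 2, q.2))
    (T := {q | q.1 = 3 / 2} ∩ ({q | 0 < n * q.2.2 - m * q.2.1} ∩ {q | n * q.2.2 - m * q.2.1 < 1}))
    ?_ ⟨(3 / 2, 0, 1 / (2 * n)), rfl, ?_, ?_⟩ ?_ (by fun_prop) (fun _ h => ⟨rfl, h.2.2⟩) ?_
  · have hl : IsLinearMap ℝ fun q : ℝ × ℝ × ℝ => n * q.2.2 - m * q.2.1 :=
      ⟨fun x y => by simp; ring, fun c x => by simp; ring⟩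
    exact (convex_hyperplane (LinearMap.isLinear (LinearMap.fst ℝ ℝ (ℝ × ℝ))) _).inter
      ((convex_halfSpace_gt hl _).inter (convex_halfSpace_lt hl _))
  · simp only [mem_ofPred_eq]; field_simp; norm_num
  · simp only [mem_ofPred_eq]; field_simp; norm_num
  · rintro ⟨ρ, φ, θ⟩ ⟨(rfl : ρ = 3 / 2), h⟩
    exact ⟨by norm_num, two_add_mul_cos_pos_of_lt (by norm_num) (by norm_num), h⟩
  · rintro ⟨ρ, φ, θ⟩ ⟨h1, h2, h3⟩ _ ⟨a, b, ha, hb, hab, rfl⟩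
    dsimp only at h1 h2 h3
    have h4 := two_add_mul_cos_pos_of_lt (ρ := 3 / 2) (x := 2 * π * φ) (by norm_num) (by norm_num)
    have e : a • (ρ, φ, θ) + b • ((3 / 2 : ℝ), φ, θ) = (a * ρ + b * (3 / 2), φ, θ) := by
      simp [← add_mul, hab]
    rw [e]
    refine ⟨convexComb_lt ha hb hab h1 (by norm_num), ?_, h3⟩
    have := convexComb_lt ha hb hab h2 h4
    dsimp only
    linear_combination this + 2 * hab

theorem contractibleSpace_innerCover (hm : m ≠ 0) (hn : n ≠ 0) :
    ContractibleSpace (innerCover m n) := by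
  refine contractibleSpace_of_segment_subset (T := {q | q.1 = 0}) (r := fun q => (0, q.2))
    ?_ ⟨(0, 0), rfl⟩ ?_ (by fun_prop) (fun _ _ => rfl) ?_
  · exact (convex_singleton (0 : ℂ)).linear_preimage (LinearMap.fst ℝ ℂ ℝ)
  · rintro ⟨w, θ⟩ (rfl : w = 0)
    exact ⟨by norm_num, .inl (by norm_num)⟩
  · rintro ⟨w, θ⟩ ⟨h1, h2⟩ _ ⟨a, b, ha, hb, hab, rfl⟩
    dsimp only at h1 h2
    have e : a • (w, θ) + b • ((0 : ℂ), θ) = ((a : ℂ) * w, θ) := by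
      simp [← add_mul, hab]
    have hpos : 0 < 2 + ((a : ℂ) * w).re := by
      have := convexComb_lt ha hb hab h1 two_pos
      rw [Complex.re_ofReal_mul]
      linear_combination this + 2 * hab
    rw [e]
    refine ⟨hpos, ?_⟩
    dsimp only
    rcases ha.eq_or_lt with rfl | ha'
    · left; simp
    refine h2.imp (fun h => ?_) fun h => ?_
    · rw [norm_mul, Complex.norm_real, norm_of_nonneg ha]
      nlinarith [norm_nonneg w]
    · have hs := isAngle_arg w
      have hs' : IsAngle (a * w : ℂ) (w.arg / (2 * π)) := by
        rw [← Complex.arg_real_mul w ha']; exact isAngle_arg _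
      rw [mem_offKnotCone_iff hm hn (isAngle_planeCoord_revolve h1.le θ)
        (by rwa [coreCoord_revolve h1.le]), coreCoord_revolve h1.le] at h
      rw [mem_offKnotCone_iff hm hn (isAngle_planeCoord_revolve hpos.le θ)
        (by rwa [coreCoord_revolve hpos.le]), coreCoord_revolve hpos.le, ← norm_ne_zero_iff,
        norm_planeCoord_revolve hpos.le]
      exact ⟨hpos.ne', mul_ne_zero (by exact_mod_cast ha'.ne') h.2.1, h.2.2⟩

end Regions

section Projections

open Set ComplexConjugate

variable {m n : ℕ}

theorem planeCoord_ne_zero_of_mem_innerRegion (hm : m ≠ 0) (hn : n ≠ 0) {x : KnotComplement m n}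
    (hx : x ∈ innerRegion m n) : planeCoord x ≠ 0 :=
  Or.elim hx (fun h => planeCoord_ne_zero_of_norm_coreCoord (h.trans one_lt_two))
    fun h => (ne_zero_of_mem_offKnotCone hm hn h).1

theorem coreCoord_ne_zero_of_mem_outerRegion (hm : m ≠ 0) (hn : n ≠ 0) {x : KnotComplement m n}
    (hx : x ∈ outerRegion m n) : coreCoord x ≠ 0 :=
  Or.elim hx (fun h => norm_pos_iff.1 (one_pos.trans h))
    fun h => (ne_zero_of_mem_offKnotCone hm hn h).2

theorem coneRegion_subset_offAxis (hm : m ≠ 0) (hn : n ≠ 0) : coneRegion m n ⊆ offAxis m n :=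
  fun _ h => (ne_zero_of_mem_offKnotCone hm hn h).1

theorem mem_innerCover (hm : m ≠ 0) (hn : n ≠ 0) {x : KnotComplement m n}
    (hx : x ∈ innerRegion m n) {θ : ℝ} (hθ : IsAngle (planeCoord x) θ) :
    (coreCoord x, θ) ∈ innerCover m n := by
  refine ⟨?_, ?_⟩
  · rw [two_add_re_coreCoord]
    exact norm_pos_iff.2 (planeCoord_ne_zero_of_mem_innerRegion hm hn hx)
  · dsimp only
    rw [revolve_coreCoord hθ]
    exact hx

theorem mem_outerCover (hm : m ≠ 0) (hn : n ≠ 0) {x : KnotComplement m n}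
    (hx : x ∈ outerRegion m n ∩ offAxis m n) {φ θ : ℝ} (hφ : IsAngle (coreCoord x) φ)
    (hθ : IsAngle (planeCoord x) θ) : (‖coreCoord x‖, φ, θ) ∈ outerCover m n := by
  refine ⟨norm_pos_iff.2 (coreCoord_ne_zero_of_mem_outerRegion hm hn hx.1), ?_, ?_⟩
  · dsimp only
    rw [two_add_mul_cos_eq hφ]
    exact norm_pos_iff.2 hx.2
  · exact hx.1.imp_right fun h => ((mem_offKnotCone_iff hm hn hθ hφ).1 h).2.2

section

variable (hm : m ≠ 0) (hn : n ≠ 0) (hmn : Nat.gcd m n = 1)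

/-- The covering map onto `innerRegion`. -/
noncomputable def innerProj (q : innerCover m n) : KnotComplement m n :=
  ⟨revolve q.1.1 q.1.2, (notMem_torusKnot_iff hm hn hmn).2 <| q.2.2.imp_left fun h => by
    rw [coreCoord_revolve q.2.1.le]; exact h.ne⟩

theorem continuous_innerProj : Continuous (innerProj hm hn hmn) :=
  (continuous_revolve.comp continuous_subtype_val).subtype_mk _

theorem innerProj_coreCoord {x : KnotComplement m n} (hx : x ∈ innerRegion m n) {θ : ℝ}
    (hθ : IsAngle (planeCoord x) θ) :
    innerProj hm hn hmn ⟨(coreCoord x, θ), mem_innerCover hm hn hx hθ⟩ = x :=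
  Subtype.ext (revolve_coreCoord hθ)

theorem innerProj_mem (q : innerCover m n) : innerProj hm hn hmn q ∈ innerRegion m n :=
  q.2.2.imp_left fun h => by
    rw [innerProj, coreCoord_revolve q.2.1.le]; exact h

theorem range_innerProj : range (innerProj hm hn hmn) = innerRegion m n := by
  refine subset_antisymm (range_subset_iff.2 (innerProj_mem hm hn hmn)) fun x hx => ?_
  exact ⟨_, innerProj_coreCoord hm hn hmn hx (isAngle_arg _)⟩

theorem isAngle_innerProj (q : innerCover m n) :
    IsAngle (planeCoord (innerProj hm hn hmn q)) q.1.2 :=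
  isAngle_planeCoord_revolve q.2.1.le _

/-- The covering map onto `outerRegion ∩ offAxis`. -/
noncomputable def outerProj (q : outerCover m n) : KnotComplement m n :=
  ⟨toroidal q, (notMem_torusKnot_iff hm hn hmn).2 <| q.2.2.2.imp (fun h => by
    rw [norm_coreCoord_toroidal q.2.1.le q.2.2.1.le]; exact h.ne')
    (toroidal_mem_offKnotCone_iff hm hn q.2.1 q.2.2.1).2⟩

theorem continuous_outerProj : Continuous (outerProj hm hn hmn) :=
  (continuous_toroidal.comp continuous_subtype_val).subtype_mk _

theorem outerProj_toroidal {x : KnotComplement m n} (hx : x ∈ outerRegion m n ∩ offAxis m n)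
    {φ θ : ℝ} (hφ : IsAngle (coreCoord x) φ) (hθ : IsAngle (planeCoord x) θ) :
    outerProj hm hn hmn ⟨(‖coreCoord x‖, φ, θ), mem_outerCover hm hn hx hφ hθ⟩ = x :=
  Subtype.ext (toroidal_eq hφ hθ)

theorem outerProj_mem (q : outerCover m n) :
    outerProj hm hn hmn q ∈ outerRegion m n ∩ offAxis m n := by
  refine ⟨q.2.2.2.imp (fun h => ?_) (toroidal_mem_offKnotCone_iff hm hn q.2.1 q.2.2.1).2,
    norm_pos_iff.1 ?_⟩
  · rw [outerProj, norm_coreCoord_toroidal q.2.1.le q.2.2.1.le]; exact h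
  · rw [outerProj, norm_planeCoord_toroidal q.2.2.1.le]; exact q.2.2.1

theorem range_outerProj : range (outerProj hm hn hmn) = outerRegion m n ∩ offAxis m n := by
  refine subset_antisymm (range_subset_iff.2 (outerProj_mem hm hn hmn)) fun x hx => ?_
  exact ⟨_, outerProj_toroidal hm hn hmn hx (isAngle_arg _) (isAngle_arg _)⟩

theorem isAngle_planeCoord_outerProj (q : outerCover m n) :
    IsAngle (planeCoord (outerProj hm hn hmn q)) q.1.2.2 :=
  isAngle_planeCoord_toroidal q.2.2.1.le

theorem isAngle_coreCoord_outerProj (q : outerCover m n) :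
    IsAngle (coreCoord (outerProj hm hn hmn q)) q.1.2.1 :=
  isAngle_coreCoord_toroidal q.2.1.le q.2.2.1.le

theorem ne_int_of_mem_coneCover {q : ℝ × ℝ × ℝ} (hq : q ∈ coneCover m n) (k : ℤ) :
    n * q.2.2 - m * q.2.1 ≠ k := fun hk => by
  have h1 : (0 : ℝ) < k := hk ▸ hq.2.2.1
  have h2 : (k : ℝ) < 1 := hk ▸ hq.2.2.2
  norm_cast at h1 h2
  omega

theorem coneCover_subset_outerCover : coneCover m n ⊆ outerCover m n := fun _ hq =>
  ⟨hq.1, hq.2.1, Or.inr (ne_int_of_mem_coneCover hq)⟩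

include hm hn hmn in
theorem exists_mem_coneCover {x : KnotComplement m n} (hx : x ∈ coneRegion m n) :
    ∃ φ θ : ℝ, IsAngle (coreCoord x) φ ∧ IsAngle (planeCoord x) θ ∧
      (‖coreCoord x‖, φ, θ) ∈ coneCover m n := by
  have h0 := ne_zero_of_mem_offKnotCone hm hn hx
  have hθ := isAngle_arg (planeCoord x)
  have hφ := isAngle_arg (coreCoord x)
  set θ := (planeCoord x).arg / (2 * π)
  set φ := (coreCoord x).arg / (2 * π)
  have hk := ((mem_offKnotCone_iff hm hn hθ hφ).1 hx).2.2
  have hb := Nat.gcd_eq_gcd_ab m n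
  rw [hmn] at hb
  set a := Nat.gcdA m n
  set b := Nat.gcdB m n
  have hb' : (1 : ℝ) = m * a + n * b := by exact_mod_cast hb
  set K := ⌊n * θ - m * φ⌋
  refine ⟨φ + (K * a : ℤ), θ + (-K * b : ℤ), hφ.add_int _, hθ.add_int _, norm_pos_iff.2 h0.2,
    ?_, ?_⟩
  · dsimp only
    rw [two_add_mul_cos_eq (hφ.add_int _)]
    exact norm_pos_iff.2 h0.1
  have e : n * (θ + (-K * b : ℤ)) - m * (φ + (K * a : ℤ)) = Int.fract (n * θ - m * φ) := by
    rw [Int.fract]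
    push_cast
    linear_combination K * hb'
  dsimp only
  rw [e]
  refine ⟨(Int.fract_nonneg _).lt_of_ne' ?_, Int.fract_lt_one _⟩
  rw [Ne, Int.fract_eq_zero_iff]
  rintro ⟨k, h⟩
  exact hk k h.symm

include hm hn hmn in
theorem isPathConnected_innerRegion : IsPathConnected (innerRegion m n) := by
  have := contractibleSpace_innerCover hm hn
  rw [← range_innerProj hm hn hmn]
  exact isPathConnected_range (continuous_innerProj hm hn hmn)

include hm hn hmn in
theorem isPathConnected_outerRegion_inter_offAxis :
    IsPathConnected (outerRegion m n ∩ offAxis m n) := by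
  have := contractibleSpace_outerCover (m := m) (n := n)
  rw [← range_outerProj hm hn hmn]
  exact isPathConnected_range (continuous_outerProj hm hn hmn)

include hm hn hmn in
theorem isPathConnected_coneRegion : IsPathConnected (coneRegion m n) := by
  have := contractibleSpace_coneCover (m := m) hn
  have e : range (outerProj hm hn hmn ∘ inclusion coneCover_subset_outerCover) =
      coneRegion m n := by
    refine subset_antisymm (range_subset_iff.2 fun q => ?_) fun x hx => ?_
    · exact (toroidal_mem_offKnotCone_iff hm hn q.2.1 q.2.2.1).2
        (ne_int_of_mem_coneCover q.2)
    · obtain ⟨φ, θ, hφ, hθ, h⟩ := exists_mem_coneCover hm hn hmn hx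
      exact ⟨⟨_, h⟩, Subtype.ext (toroidal_eq hφ hθ)⟩
  rw [← e]
  exact isPathConnected_range ((continuous_outerProj hm hn hmn).comp (continuous_inclusion _))

theorem convex_norm_planeCoord_lt_one : Convex ℝ {p : ℝ × ℝ × ℝ | ‖planeCoord p‖ < 1} := by
  have hl : IsLinearMap ℝ planeCoord :=
    ⟨fun x y => by apply Complex.ext <;> simp [planeCoord],
      fun c x => by apply Complex.ext <;> simp [planeCoord]⟩
  have := (convex_ball (0 : ℂ) 1).is_linear_preimage hl
  simpa [preimage, Metric.ball, dist_zero_right] using this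

theorem contractibleSpace_norm_planeCoord_lt_one :
    ContractibleSpace {p : ℝ × ℝ × ℝ | ‖planeCoord p‖ < 1} :=
  convex_norm_planeCoord_lt_one.contractibleSpace ⟨0, by
    have : planeCoord 0 = 0 := rfl
    simp [this]⟩

/-- The inclusion of the tube around the axis in the complement of the knot. -/
def axisIncl (p : {p : ℝ × ℝ × ℝ | ‖planeCoord p‖ < 1}) : KnotComplement m n :=
  ⟨p, (notMem_torusKnot_iff hm hn hmn).2 (Or.inl (one_lt_norm_coreCoord p.2).ne')⟩

theorem continuous_axisIncl : Continuous (axisIncl hm hn hmn) :=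
  continuous_subtype_val.subtype_mk _

include hm hn hmn in
theorem isPathConnected_axisTube : IsPathConnected (axisTube m n) := by
  have := contractibleSpace_norm_planeCoord_lt_one
  have e : range (axisIncl hm hn hmn) = axisTube m n :=
    subset_antisymm (range_subset_iff.2 fun q => q.2) fun x hx => ⟨⟨x, hx⟩, rfl⟩
  rw [← e]
  exact isPathConnected_range (continuous_axisIncl hm hn hmn)

include hm hn hmn in
theorem isPathConnected_axisTube_inter_offAxis :
    IsPathConnected (axisTube m n ∩ offAxis m n) := by
  have e : {p | ‖planeCoord p‖ < 1 ∧ planeCoord p ≠ 0} =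
      (fun q : ℝ × ℝ × ℝ => revolve ⟨q.1 - 2, q.2.1⟩ q.2.2) '' (Ioo 0 1 ×ˢ univ) := by
    ext p
    constructor
    · intro hp
      exact ⟨(‖planeCoord p‖, p.2.2, _), ⟨⟨norm_pos_iff.2 hp.2, hp.1⟩, trivial⟩,
        revolve_coreCoord (isAngle_arg _)⟩
    · rintro ⟨q, ⟨⟨h0, h1⟩, -⟩, rfl⟩
      have h := norm_planeCoord_revolve (w := ⟨q.1 - 2, q.2.1⟩) (by simpa using h0.le) q.2.2
      have h' : ‖planeCoord (revolve ⟨q.1 - 2, q.2.1⟩ q.2.2)‖ = q.1 := by simpa using h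
      exact ⟨h'.trans_lt h1, norm_pos_iff.1 (h0.trans_eq h'.symm)⟩
  refine IsPathConnected.preimage_coe (W := {p | ‖planeCoord p‖ < 1 ∧ planeCoord p ≠ 0}) ?_
    fun p hp => (axisIncl hm hn hmn ⟨p, hp.1⟩).2
  rw [e]
  exact (((convex_Ioo 0 1).prod convex_univ).isPathConnected ⟨(1 / 2, 0), by norm_num⟩).image
    (continuous_revolve.comp (f := fun q : ℝ × ℝ × ℝ => ((⟨q.1 - 2, q.2.1⟩ : ℂ), q.2.2))
      ((continuous_complexMk (by fun_prop) (by fun_prop)).prodMk (by fun_prop)))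

end

end Projections

section Loops

open Set unitInterval

variable {m n : ℕ} {x₀ : KnotComplement m n}

/-- A loop in `innerRegion` whose angle around the axis lifts from `θ₀` to `θ₀ + j`. -/
def InnerLift (θ₀ : ℝ) (j : ℤ) (γ : Path x₀ x₀) : Prop :=
  ∃ θ : I → ℝ, Continuous θ ∧ θ 0 = θ₀ ∧ θ 1 = θ₀ + j ∧
    ∀ t, γ t ∈ innerRegion m n ∧ IsAngle (planeCoord (γ t)) (θ t)

/-- A loop in `outerRegion` off the axis whose angles around the core circle and around the axis
lift from `φ₀` to `φ₀ + i` and from `θ₀` to `θ₀ + j`. -/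
def OuterLift (φ₀ θ₀ : ℝ) (i j : ℤ) (γ : Path x₀ x₀) : Prop :=
  ∃ φ θ : I → ℝ, Continuous φ ∧ Continuous θ ∧ φ 0 = φ₀ ∧ φ 1 = φ₀ + i ∧ θ 0 = θ₀ ∧ θ 1 = θ₀ + j ∧
    ∀ t, γ t ∈ outerRegion m n ∩ offAxis m n ∧ IsAngle (coreCoord (γ t)) (φ t) ∧
      IsAngle (planeCoord (γ t)) (θ t)

theorem exists_innerLift (hm : m ≠ 0) (hn : n ≠ 0) {θ₀ : ℝ} (hθ₀ : IsAngle (planeCoord x₀) θ₀)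
    {γ : Path x₀ x₀} (hγ : range γ ⊆ innerRegion m n) : ∃ j, InnerLift θ₀ j γ := by
  have hγ' t : γ t ∈ innerRegion m n := hγ ⟨t, rfl⟩
  have h0 t := planeCoord_ne_zero_of_mem_innerRegion hm hn (hγ' t)
  obtain ⟨θ, hθ, hθ0, hθ'⟩ := exists_isAngle_lift (f := fun t => planeCoord (γ t)) (by fun_prop) h0
    (by simpa using hθ₀)
  have h1 := hθ' 1
  rw [γ.target] at h1
  obtain ⟨j, hj⟩ := h1.exists_int (by simpa using h0 0) hθ₀
  exact ⟨j, θ, hθ, hθ0, hj, fun t => ⟨hγ' t, hθ' t⟩⟩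

theorem exists_outerLift (hm : m ≠ 0) (hn : n ≠ 0) {φ₀ θ₀ : ℝ} (hφ₀ : IsAngle (coreCoord x₀) φ₀)
    (hθ₀ : IsAngle (planeCoord x₀) θ₀) {γ : Path x₀ x₀}
    (hγ : range γ ⊆ outerRegion m n ∩ offAxis m n) : ∃ i j, OuterLift φ₀ θ₀ i j γ := by
  have hγ' t : γ t ∈ outerRegion m n ∩ offAxis m n := hγ ⟨t, rfl⟩
  have h0 t : planeCoord (γ t) ≠ 0 := (hγ' t).2
  have h0' t : coreCoord (γ t) ≠ 0 := coreCoord_ne_zero_of_mem_outerRegion hm hn (hγ' t).1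
  obtain ⟨θ, hθ, hθ0, hθ'⟩ := exists_isAngle_lift (f := fun t => planeCoord (γ t)) (by fun_prop) h0
    (by simpa using hθ₀)
  obtain ⟨φ, hφ, hφ0, hφ'⟩ := exists_isAngle_lift (f := fun t => coreCoord (γ t)) (by fun_prop) h0'
    (by simpa using hφ₀)
  have h1 := hθ' 1
  have h2 := hφ' 1
  rw [γ.target] at h1 h2
  obtain ⟨j, hj⟩ := h1.exists_int (by simpa using h0 0) hθ₀
  obtain ⟨i, hi⟩ := h2.exists_int (by simpa using h0' 0) hφ₀
  exact ⟨i, j, φ, θ, hφ, hθ, hφ0, hi, hθ0, hj, fun t => ⟨hγ' t, hφ' t, hθ' t⟩⟩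

variable (hm : m ≠ 0) (hn : n ≠ 0) (hmn : Nat.gcd m n = 1)

include hm hn hmn

theorem exists_deckHom_inner (hx₀ : x₀ ∈ innerRegion m n) {θ₀ : ℝ}
    (hθ₀ : IsAngle (planeCoord x₀) θ₀) :
    ∃ Φ : Multiplicative ℤ →* FundamentalGroup (KnotComplement m n) x₀,
      (∀ (γ : Path x₀ x₀) (j : ℤ), InnerLift θ₀ j γ → loopClass γ = Φ (.ofAdd j)) ∧
      ∃ γ : Path x₀ x₀, InnerLift θ₀ 1 γ := by
  have := contractibleSpace_innerCover hm hn
  let τ (j : ℤ) (q : innerCover m n) : innerCover m n := ⟨(q.1.1, q.1.2 + j), by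
    simpa only [innerCover, mem_ofPred_eq, revolve_add_int] using q.2⟩
  have hτ j : Continuous (τ j) := by fun_prop
  have hfτ (j : ℤ) q : innerProj hm hn hmn (τ j q) = innerProj hm hn hmn q :=
    Subtype.ext (revolve_add_int _ _ j)
  have h₀ := innerProj_coreCoord hm hn hmn hx₀ hθ₀
  set d₀ : innerCover m n := ⟨(coreCoord x₀, θ₀), mem_innerCover hm hn hx₀ hθ₀⟩
  obtain ⟨Φ, hΦ⟩ := exists_deckHom (continuous_innerProj hm hn hmn) hτ
    (fun a b q => Subtype.ext (Prod.ext rfl (by simp only [τ]; push_cast; ring))) hfτ h₀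
  refine ⟨Φ, ?_, ?_⟩
  · rintro γ j ⟨θ, hθ, hθ0, hθ1, h⟩
    refine hΦ γ j ⟨⟨fun t => ⟨(coreCoord (γ t), θ t), mem_innerCover hm hn (h t).1 (h t).2⟩,
      by fun_prop⟩, ?_, ?_⟩ fun t => ?_
    · simp [d₀, hθ0]
    · simp [d₀, τ, hθ1]
    · exact innerProj_coreCoord hm hn hmn (h t).1 (h t).2
  · let δ := PathConnectedSpace.somePath d₀ (τ 1 d₀)
    refine ⟨(δ.map (continuous_innerProj hm hn hmn)).cast h₀.symm ((hfτ 1 d₀).trans h₀).symm,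
      fun t => (δ t).1.2, by fun_prop, by simp [d₀], by simp [d₀, τ], fun t => ⟨?_, ?_⟩⟩
    · exact innerProj_mem hm hn hmn _
    · exact isAngle_innerProj hm hn hmn _

theorem exists_deckHom_outer (hx₀ : x₀ ∈ outerRegion m n ∩ offAxis m n) {φ₀ θ₀ : ℝ}
    (hφ₀ : IsAngle (coreCoord x₀) φ₀) (hθ₀ : IsAngle (planeCoord x₀) θ₀) :
    ∃ Φ : Multiplicative (ℤ × ℤ) →* FundamentalGroup (KnotComplement m n) x₀,
      ∀ (γ : Path x₀ x₀) (i j : ℤ), OuterLift φ₀ θ₀ i j γ → loopClass γ = Φ (.ofAdd (i, j)) := by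
  have := contractibleSpace_outerCover (m := m) (n := n)
  let τ (a : ℤ × ℤ) (q : outerCover m n) : outerCover m n :=
    ⟨(q.1.1, q.1.2.1 + a.1, q.1.2.2 + a.2), q.2.1, by
      have := congr_arg Complex.re (cis_add_int q.1.2.1 a.1)
      simp only [cis_re] at this
      simpa only [this] using q.2.2.1, q.2.2.2.imp_right fun h k hk =>
      h (k - n * a.2 + m * a.1) (by push_cast; rw [← hk]; ring)⟩
  have hτ a : Continuous (τ a) := by fun_prop
  have hfτ a q : outerProj hm hn hmn (τ a q) = outerProj hm hn hmn q := by
    refine Subtype.ext ?_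
    simp only [outerProj, τ, toroidal, revolve_add_int, cis_add_int]
  have h₀ := outerProj_toroidal hm hn hmn hx₀ hφ₀ hθ₀
  set d₀ : outerCover m n := ⟨(‖coreCoord x₀‖, φ₀, θ₀), mem_outerCover hm hn hx₀ hφ₀ hθ₀⟩
  obtain ⟨Φ, hΦ⟩ := exists_deckHom (continuous_outerProj hm hn hmn) hτ
    (fun a b q => Subtype.ext (Prod.ext rfl (Prod.ext
      (by simp only [τ, Prod.fst_add]; push_cast; ring)
      (by simp only [τ, Prod.snd_add]; push_cast; ring)))) hfτ h₀
  refine ⟨Φ, ?_⟩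
  rintro γ i j ⟨φ, θ, hφ, hθ, hφ0, hφ1, hθ0, hθ1, h⟩
  refine hΦ γ (i, j) ⟨⟨fun t => ⟨(‖coreCoord (γ t)‖, φ t, θ t),
    mem_outerCover hm hn (h t).1 (h t).2.1 (h t).2.2⟩, by fun_prop⟩, ?_, ?_⟩ fun t => ?_
  · simp [d₀, hθ0, hφ0]
  · simp [d₀, τ, hθ1, hφ1]
  · exact outerProj_toroidal hm hn hmn (h t).1 (h t).2.1 (h t).2.2

theorem loopClass_eq_one_of_axisTube {γ : Path x₀ x₀} (hγ : range γ ⊆ axisTube m n) :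
    loopClass γ = 1 := by
  have := contractibleSpace_norm_planeCoord_lt_one
  have hγ' t : ‖planeCoord (γ t)‖ < 1 := hγ ⟨t, rfl⟩
  have h0 : ‖planeCoord x₀‖ < 1 := by simpa using hγ' 0
  rw [← loopClass_refl, loopClass_eq_iff]
  exact homotopic_of_lift (continuous_axisIncl hm hn hmn)
    (d := ⟨x₀, h0⟩) (e := ⟨x₀, h0⟩)
    ⟨⟨fun t => ⟨γ t, hγ' t⟩, by fun_prop⟩, by simp, by simp⟩ (Path.refl _) (fun t => rfl)
    fun t => rfl

theorem inner_union_outer_union_axisTube :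
    innerRegion m n ∪ outerRegion m n ∩ offAxis m n ∪ axisTube m n = univ := by
  refine eq_univ_of_forall fun x => ?_
  rcases (notMem_torusKnot_iff hm hn hmn).1 x.2 with h | h
  · rcases h.lt_or_gt with h | h
    · exact .inl (.inl (.inl h))
    by_cases h0 : planeCoord x = 0
    · right; simp [axisTube, h0]
    · exact .inl (.inr ⟨.inl h, h0⟩)
  · exact .inl (.inl (.inr h))

omit hmn in
theorem inner_inter_outer_inter_offAxis :
    innerRegion m n ∩ (outerRegion m n ∩ offAxis m n) = coneRegion m n := by
  rw [← inter_assoc, inner_inter_outer, inter_eq_left]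
  exact coneRegion_subset_offAxis hm hn

omit hmn in
theorem inner_union_outer_inter_axisTube :
    (innerRegion m n ∪ outerRegion m n ∩ offAxis m n) ∩ axisTube m n =
      axisTube m n ∩ offAxis m n := by
  ext x
  constructor
  · rintro ⟨h | h, h'⟩
    · exact ⟨h', planeCoord_ne_zero_of_mem_innerRegion hm hn h⟩
    · exact ⟨h', h.2⟩
  · exact fun h => ⟨.inr ⟨axisTube_subset_outerRegion h.1, h.2⟩, h.1⟩

theorem isPathConnected_inner_union_outer :
    IsPathConnected (innerRegion m n ∪ outerRegion m n ∩ offAxis m n) := by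
  refine (isPathConnected_innerRegion hm hn hmn).union
    (isPathConnected_outerRegion_inter_offAxis hm hn hmn) ?_
  rw [inner_inter_outer_inter_offAxis hm hn]
  exact (isPathConnected_coneRegion hm hn hmn).nonempty

theorem pathConnectedSpace_knotComplement : PathConnectedSpace (KnotComplement m n) := by
  rw [pathConnectedSpace_iff_univ, ← inner_union_outer_union_axisTube hm hn hmn]
  refine (isPathConnected_inner_union_outer hm hn hmn).union
    (isPathConnected_axisTube hm hn hmn) ?_
  rw [inner_union_outer_inter_axisTube hm hn]
  exact (isPathConnected_axisTube_inter_offAxis hm hn hmn).nonempty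

theorem loopClass_mem_of_covering (hx₀ : x₀ ∈ coneRegion m n) (hx₀' : x₀ ∈ axisTube m n)
    (H : Subgroup (FundamentalGroup (KnotComplement m n) x₀))
    (h1 : ∀ γ : Path x₀ x₀, range γ ⊆ innerRegion m n → loopClass γ ∈ H)
    (h2 : ∀ γ : Path x₀ x₀, range γ ⊆ outerRegion m n ∩ offAxis m n → loopClass γ ∈ H) :
    H = ⊤ := by
  have := pathConnectedSpace_knotComplement hm hn hmn
  have hx₀'' := inner_inter_outer_inter_offAxis hm hn ▸ hx₀
  refine (Subgroup.eq_top_iff' _).2 fun g => ?_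
  obtain ⟨γ, rfl⟩ := loopClass_surjective g
  refine loopClass_mem_of_range_subset_union (S := innerRegion m n ∪ outerRegion m n ∩ offAxis m n)
    (T := axisTube m n) (isOpen_innerRegion.union (isOpen_outerRegion.inter isOpen_offAxis))
    isOpen_axisTube (isPathConnected_inner_union_outer hm hn hmn)
    (isPathConnected_axisTube hm hn hmn) ?_ ⟨.inl hx₀''.1, hx₀'⟩ H ?_ ?_ γ ?_
  · rw [inner_union_outer_inter_axisTube hm hn]
    exact isPathConnected_axisTube_inter_offAxis hm hn hmn
  · exact loopClass_mem_of_range_subset_union isOpen_innerRegion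
      (isOpen_outerRegion.inter isOpen_offAxis) (isPathConnected_innerRegion hm hn hmn)
      (isPathConnected_outerRegion_inter_offAxis hm hn hmn)
      (inner_inter_outer_inter_offAxis hm hn ▸ isPathConnected_coneRegion hm hn hmn) hx₀'' H h1 h2
  · intro γ hγ
    rw [loopClass_eq_one_of_axisTube hm hn hmn hγ]
    exact one_mem H
  · rw [inner_union_outer_union_axisTube hm hn hmn]
    exact subset_univ _

theorem exists_windingLoop {φ₀ θ₀ : ℝ} (hx₀ : (x₀ : ℝ × ℝ × ℝ) = toroidal (3 / 2, φ₀, θ₀))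
    (i j : ℤ) : ∃ γ : Path x₀ x₀,
      (∀ t, (γ t : ℝ × ℝ × ℝ) = toroidal (3 / 2, φ₀ + t * i, θ₀ + t * j)) ∧
      OuterLift φ₀ θ₀ i j γ := by
  let δ (t : I) : outerCover m n := ⟨(3 / 2, φ₀ + t * i, θ₀ + t * j), by norm_num,
    two_add_mul_cos_pos_of_lt (by norm_num) (by norm_num), .inl (by norm_num)⟩
  have hδ : Continuous δ := by fun_prop
  refine ⟨⟨⟨fun t => outerProj hm hn hmn (δ t), (continuous_outerProj hm hn hmn).comp hδ⟩, ?_, ?_⟩,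
    fun t => rfl, fun t => φ₀ + t * i, fun t => θ₀ + t * j, by fun_prop, by fun_prop,
    by simp, by simp, by simp, by simp, fun t => ⟨?_, ?_, ?_⟩⟩
  · exact Subtype.ext (by simp [outerProj, δ, hx₀])
  · exact Subtype.ext (by simp [outerProj, δ, hx₀, toroidal, revolve_add_int, cis_add_int])
  · exact outerProj_mem hm hn hmn (δ t)
  · exact isAngle_coreCoord_outerProj hm hn hmn (δ t)
  · exact isAngle_planeCoord_outerProj hm hn hmn (δ t)

theorem exists_basePoint : ∃ (x₀ : KnotComplement m n) (θ₀ : ℝ),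
    (x₀ : ℝ × ℝ × ℝ) = toroidal (3 / 2, 1 / 2, θ₀) ∧ n * θ₀ - m * (1 / 2) = 1 / 2 := by
  have h : (n : ℝ) ≠ 0 := Nat.cast_ne_zero.2 hn
  exact ⟨outerProj hm hn hmn ⟨(3 / 2, 1 / 2, (m + 1) / (2 * n)), by norm_num,
    two_add_mul_cos_pos_of_lt (by norm_num) (by norm_num), .inl (by norm_num)⟩,
    (m + 1) / (2 * n), rfl, by field_simp; ring⟩

/-- The fundamental group is generated by the core loop of `innerRegion` and the meridian loop
around the core circle, with the expected relation. -/
theorem exists_generators : ∃ (x₀ : KnotComplement m n) (φ₀ θ₀ : ℝ) (γ γ' : Path x₀ x₀),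
    IsAngle (coreCoord x₀) φ₀ ∧ IsAngle (planeCoord x₀) θ₀ ∧ x₀ ∈ coneRegion m n ∧
    n * θ₀ - m * φ₀ = 1 / 2 ∧ InnerLift θ₀ 1 γ ∧ OuterLift φ₀ θ₀ 1 0 γ' ∧
    loopClass γ ^ m = loopClass γ' ^ n ∧
    Subgroup.closure {loopClass γ, loopClass γ'} = ⊤ := by
  obtain ⟨x₀, θ₀, hx₀, hθ₀⟩ := exists_basePoint hm hn hmn
  have hpos (x : ℝ) : 0 < 2 + 3 / 2 * cos x :=
    two_add_mul_cos_pos_of_lt (by norm_num) (by norm_num)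
  have hcone {x : KnotComplement m n} {φ θ : ℝ} (hx : (x : ℝ × ℝ × ℝ) = toroidal (3 / 2, φ, θ))
      (h : n * θ - m * φ = 1 / 2) : x ∈ coneRegion m n := by
    rw [coneRegion, mem_ofPred_eq, hx]
    refine (toroidal_mem_offKnotCone_iff hm hn (by norm_num) (hpos _)).2
      (ne_int_of_mem_coneCover ⟨by norm_num, hpos _, ?_, ?_⟩) <;> dsimp only <;> rw [h] <;> norm_num
  have haxis {x : KnotComplement m n} {θ : ℝ}
      (hx : (x : ℝ × ℝ × ℝ) = toroidal (3 / 2, 1 / 2, θ)) : x ∈ axisTube m n := by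
    have : 2 * π * (1 / 2) = π := by ring
    rw [axisTube, mem_ofPred_eq, hx, norm_planeCoord_toroidal (hpos _).le]
    norm_num [this]
  have hx := hcone hx₀ hθ₀
  have hx' := inner_inter_outer_inter_offAxis hm hn ▸ hx
  have hp : IsAngle (planeCoord x₀) θ₀ := hx₀ ▸ isAngle_planeCoord_toroidal (hpos _).le
  have hc : IsAngle (coreCoord x₀) (1 / 2) :=
    hx₀ ▸ isAngle_coreCoord_toroidal (by norm_num) (hpos _).le
  obtain ⟨Φ, hΦ, γ, hγ⟩ := exists_deckHom_inner hm hn hmn hx'.1 hp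
  obtain ⟨Ψ, hΨ⟩ := exists_deckHom_outer hm hn hmn hx'.2 hc hp
  obtain ⟨β, -, hβ⟩ := exists_windingLoop hm hn hmn hx₀ 1 0
  obtain ⟨ρ, hρ, hρ'⟩ := exists_windingLoop hm hn hmn hx₀ 0 1
  obtain ⟨κ, hκ, hκ'⟩ := exists_windingLoop hm hn hmn hx₀ n m
  have hΦ_eq (j : ℤ) : Φ (.ofAdd j) = loopClass γ ^ j := by
    rw [hΦ γ 1 hγ, ← map_zpow, ← ofAdd_zsmul, smul_eq_mul, mul_one]
  have hΨ_eq (i j : ℤ) : Ψ (.ofAdd (i, j)) = loopClass β ^ i := by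
    have hρ1 : Ψ (.ofAdd (0, 1)) = 1 := by
      rw [← hΨ ρ 0 1 hρ']
      refine loopClass_eq_one_of_axisTube hm hn hmn (range_subset_iff.2 fun t => ?_)
      exact haxis (by simpa using hρ t)
    have : ((i, j) : ℤ × ℤ) = i • (1, 0) + j • (0, 1) := by simp
    rw [this, ofAdd_add, map_mul, ofAdd_zsmul, ofAdd_zsmul, map_zpow, map_zpow, hρ1,
      ← hΨ β 1 0 hβ, one_zpow, mul_one]
  refine ⟨x₀, 1 / 2, θ₀, γ, β, hc, hp, hx, hθ₀, hγ, hβ, ?_, ?_⟩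
  · have h1 : InnerLift θ₀ m κ := by
      obtain ⟨φ, θ, -, hθ, -, -, h0, h1, h⟩ := hκ'
      refine ⟨θ, hθ, h0, h1, fun t => ⟨?_, (h t).2.2⟩⟩
      exact .inr (hcone (hκ t) (by push_cast; linear_combination hθ₀))
    rw [← zpow_natCast, ← zpow_natCast, ← hΦ_eq, ← hΨ_eq n m, ← hΦ κ m h1, hΨ κ n m hκ']
  · refine loopClass_mem_of_covering hm hn hmn hx (haxis hx₀) _ (fun δ hδ => ?_) fun δ hδ => ?_
    · obtain ⟨j, hj⟩ := exists_innerLift hm hn hp hδ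
      rw [hΦ δ j hj, hΦ_eq]
      exact zpow_mem (Subgroup.subset_closure (by simp)) j
    · obtain ⟨i, j, hj⟩ := exists_outerLift hm hn hc hp hδ
      rw [hΨ δ i j hj, hΨ_eq]
      exact zpow_mem (Subgroup.subset_closure (by simp)) i

end Loops

section Monodromy

open Topology unitInterval

theorem eventually_floor_eq {X : Type*} [TopologicalSpace X] {x : X} {u : X → ℝ}
    (hu : ContinuousAt u x) (h : ∀ k : ℤ, u x ≠ k) : ∀ᶠ y in 𝓝 x, ⌊u y⌋ = ⌊u x⌋ := by
  filter_upwards [hu (Ioo_mem_nhds ((Int.floor_le _).lt_of_ne' (h _)) (Int.lt_floor_add_one _))]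
    with y hy
  exact Int.floor_eq_iff.2 ⟨hy.1.le, hy.2⟩

/-- The difference between the angles of `z` given by `angleNear c` and by the argument. -/
noncomputable def angleShift (c z : ℂ) : ℤ := round (angleNear c z - z.arg / (2 * π))

theorem angleNear_eq {c z : ℂ} (hc : c ≠ 0) (hz : z ≠ 0) :
    angleNear c z = z.arg / (2 * π) + angleShift c z := by
  obtain ⟨k, hk⟩ := (isAngle_angleNear hc z).exists_int hz (isAngle_arg z)
  rw [angleShift, hk, add_sub_cancel_left, round_intCast]

theorem ne_zero_of_div_mem_slitPlane {c z : ℂ} (h : z / c ∈ Complex.slitPlane) :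
    c ≠ 0 ∧ z ≠ 0 := by
  have := Complex.slitPlane_ne_zero h
  rw [div_ne_zero_iff] at this
  exact this.symm

theorem eventually_angleShift_sub_eq {X : Type*} [TopologicalSpace X] {f : X → ℂ} {x : X}
    (hf : Continuous f) {c c' : ℂ} (h : f x / c ∈ Complex.slitPlane)
    (h' : f x / c' ∈ Complex.slitPlane) :
    ∀ᶠ y in 𝓝 x, angleShift c' (f y) - angleShift c (f y) =
      angleShift c' (f x) - angleShift c (f x) := by
  obtain ⟨hc, hx⟩ := ne_zero_of_div_mem_slitPlane h
  obtain ⟨hc', -⟩ := ne_zero_of_div_mem_slitPlane h'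
  have hx' : ∀ᶠ y in 𝓝 x, f y ≠ 0 := hf.continuousAt.eventually_ne hx
  obtain ⟨k, hk⟩ := eventually_eq_of_exists_int
    ((continuousAt_angleNear h').comp hf.continuousAt)
    ((continuousAt_angleNear h).comp hf.continuousAt) (hx'.mono fun y hy =>
      (isAngle_angleNear hc' (f y)).exists_int hy (isAngle_angleNear hc (f y)))
  have key : ∀ᶠ y in 𝓝 x, angleShift c' (f y) - angleShift c (f y) = k := by
    filter_upwards [hk, hx'] with y h1 h2
    simp only [Function.comp, angleNear_eq hc h2, angleNear_eq hc' h2] at h1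
    have : (angleShift c' (f y) : ℝ) - angleShift c (f y) = k := by linear_combination h1
    exact_mod_cast this
  exact key.mono fun y hy => hy.trans key.self_of_nhds.symm

theorem eventually_zpow_angleShift_mul {X G : Type*} [TopologicalSpace X] [Group G] (g : G)
    {f : X → ℂ} {θ : X → ℝ} {t : X} (hf : Continuous f) (hθ : Continuous θ)
    (h : ∀ s, IsAngle (f s) (θ s)) (h0 : f t ≠ 0) :
    ∀ᶠ s in 𝓝 t, g ^ angleShift (f t) (f s) * g ^ round ((f s).arg / (2 * π) - θ s) =
      g ^ angleShift (f t) (f t) * g ^ round ((f t).arg / (2 * π) - θ t) := by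
  have h0' : ∀ᶠ s in 𝓝 t, f s ≠ 0 := hf.continuousAt.eventually_ne h0
  have h1 : f t / f t ∈ Complex.slitPlane := by simp [h0]
  obtain ⟨k, hk⟩ := eventually_eq_of_exists_int
    ((continuousAt_angleNear h1).comp hf.continuousAt) hθ.continuousAt
    (h0'.mono fun s hs => (isAngle_angleNear h0 (f s)).exists_int hs (h s))
  have key : ∀ᶠ s in 𝓝 t, g ^ angleShift (f t) (f s) * g ^ round ((f s).arg / (2 * π) - θ s) =
      g ^ k := by
    filter_upwards [hk, h0'] with s hs hs0
    simp only [Function.comp, angleNear_eq h0 hs0] at hs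
    have : (f s).arg / (2 * π) - θ s = (k - angleShift (f t) (f s) : ℤ) := by
      push_cast; linear_combination hs
    rw [this, round_intCast, ← zpow_add, add_sub_cancel]
  exact key.mono fun s hs => hs.trans key.self_of_nhds.symm

variable {G : Type*} [Group G]

/-- The powers of `a` and `b` that generate the subgroup containing `a ^ m = b ^ n`. -/
def transition (m n : ℕ) (a b : G) (K : ℤ) : G :=
  a ^ (Nat.gcdB m n * K) * b ^ (Nat.gcdA m n * K)

theorem transition_add {m n : ℕ} (hmn : Nat.gcd m n = 1) {a b : G} (hab : a ^ m = b ^ n)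
    (K i j : ℤ) : transition m n a b (K + (n * i - m * j)) =
      a ^ i * transition m n a b K * b ^ (-j) := by
  have hb := Nat.gcd_eq_gcd_ab m n
  rw [hmn, Nat.cast_one] at hb
  rw [transition, transition]
  set p := Nat.gcdA m n
  set q := Nat.gcdB m n
  have hz (k : ℤ) : a ^ (m * k) = b ^ (n * k) := by
    rw [zpow_mul, zpow_mul, zpow_natCast, zpow_natCast, hab]
  have e1 : q * (K + (n * i - m * j)) = i + q * K + m * (-(p * i) - q * j) := by
    linear_combination (-i) * hb
  have e2 : p * (K + (n * i - m * j)) = n * (p * i + q * j) + (p * K + -j) := by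
    linear_combination j * hb
  have e3 : b ^ (n * (p * i + q * j)) = a ^ (m * (p * i + q * j)) := (hz _).symm
  rw [e1, e2, zpow_add b, e3, ← mul_assoc, ← zpow_add]
  have e4 : i + q * K + m * (-(p * i) - q * j) + m * (p * i + q * j) = i + q * K := by ring
  rw [e4, zpow_add, zpow_add]
  group

/-- The transition between the standard choices of angles at a point. -/
noncomputable def argTransition (m n : ℕ) (a b : G) (x : KnotComplement m n) : G :=
  transition m n a b ⌊n * ((planeCoord x).arg / (2 * π)) - m * ((coreCoord x).arg / (2 * π))⌋

theorem argTransition_eq {m n : ℕ} (hmn : Nat.gcd m n = 1) {a b : G} (hab : a ^ m = b ^ n)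
    {x : KnotComplement m n} {s s' : ℝ} {i j : ℤ}
    (hs : s = (planeCoord x).arg / (2 * π) + i) (hs' : s' = (coreCoord x).arg / (2 * π) + j) :
    transition m n a b ⌊n * s - m * s'⌋ = a ^ i * argTransition m n a b x * b ^ (-j) := by
  have : n * s - m * s' = n * ((planeCoord x).arg / (2 * π)) - m * ((coreCoord x).arg / (2 * π)) +
      (n * i - m * j : ℤ) := by
    rw [hs, hs']; push_cast; ring
  rw [this, Int.floor_add_intCast, transition_add hmn hab, argTransition]

/-- The domains of the charts of the covering with group `G`. -/
def chartDomain (m n : ℕ) : Bool × ℂ → Set (KnotComplement m n)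
  | (true, c) => {x | x ∈ innerRegion m n ∧ planeCoord x / c ∈ Complex.slitPlane}
  | (false, c) => {x | x ∈ outerRegion m n ∧ coreCoord x / c ∈ Complex.slitPlane}

/-- The charts of the covering with group `G`. -/
noncomputable def chart (m n : ℕ) (a b : G) : Bool × ℂ → KnotComplement m n → G
  | (true, c), x => a ^ angleShift c (planeCoord x)
  | (false, c), x => b ^ angleShift c (coreCoord x) * (argTransition m n a b x)⁻¹

variable {m n : ℕ} (hm : m ≠ 0) (hn : n ≠ 0) (hmn : Nat.gcd m n = 1) {a b : G}

theorem isOpen_chartDomain : ∀ i, IsOpen (chartDomain m n i)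
  | (true, c) => isOpen_innerRegion.inter <| Complex.isOpen_slitPlane.preimage <| by fun_prop
  | (false, c) => isOpen_outerRegion.inter <| Complex.isOpen_slitPlane.preimage <| by fun_prop

include hm hn in
theorem mem_chartDomain_true {x : KnotComplement m n} (hx : x ∈ innerRegion m n) :
    x ∈ chartDomain m n (true, planeCoord x) :=
  ⟨hx, by simp [planeCoord_ne_zero_of_mem_innerRegion hm hn hx]⟩

include hm hn in
theorem mem_chartDomain_false {x : KnotComplement m n} (hx : x ∈ outerRegion m n) :
    x ∈ chartDomain m n (false, coreCoord x) :=
  ⟨hx, by simp [coreCoord_ne_zero_of_mem_outerRegion hm hn hx]⟩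

include hm hn hmn in
theorem exists_mem_chartDomain (x : KnotComplement m n) : ∃ i, x ∈ chartDomain m n i := by
  rcases (notMem_torusKnot_iff hm hn hmn).1 x.2 with h | h
  · rcases h.lt_or_gt with h | h
    · exact ⟨_, mem_chartDomain_true hm hn (.inl h)⟩
    · exact ⟨_, mem_chartDomain_false hm hn (.inl h)⟩
  · exact ⟨_, mem_chartDomain_true hm hn (.inr h)⟩

include hm hn hmn in
theorem eventually_chart_false_true (hab : a ^ m = b ^ n) {c c' : ℂ} {x : KnotComplement m n}
    (h : x ∈ chartDomain m n (true, c)) (h' : x ∈ chartDomain m n (false, c')) :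
    ∀ᶠ y in 𝓝 x, chart m n a b (false, c') y * (chart m n a b (true, c) y)⁻¹ =
      chart m n a b (false, c') x * (chart m n a b (true, c) x)⁻¹ := by
  have hx : x ∈ coneRegion m n := inner_inter_outer ▸ ⟨h.1, h'.1⟩
  have hx0 := ne_zero_of_mem_offKnotCone hm hn hx
  obtain ⟨hc, -⟩ := ne_zero_of_div_mem_slitPlane h.2
  obtain ⟨hc', -⟩ := ne_zero_of_div_mem_slitPlane h'.2
  let u (y : KnotComplement m n) : ℝ :=
    n * angleNear c (planeCoord y) - m * angleNear c' (coreCoord y)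
  have hu : ContinuousAt u x := by
    refine (continuousAt_const.mul ?_).sub (continuousAt_const.mul ?_)
    · exact (continuousAt_angleNear h.2).comp (f := fun y : KnotComplement m n => planeCoord y)
        (by fun_prop)
    · exact (continuousAt_angleNear h'.2).comp (f := fun y : KnotComplement m n => coreCoord y)
        (by fun_prop)
  have hux : ∀ k : ℤ, u x ≠ k :=
    ((mem_offKnotCone_iff hm hn (isAngle_angleNear hc _) (isAngle_angleNear hc' _)).1 hx).2.2
  have key : ∀ᶠ y in 𝓝 x, chart m n a b (false, c') y * (chart m n a b (true, c) y)⁻¹ =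
      (transition m n a b ⌊u x⌋)⁻¹ := by
    have h1 : ∀ᶠ y : KnotComplement m n in 𝓝 x, planeCoord y ≠ 0 :=
      ContinuousAt.eventually_ne (by fun_prop) hx0.1
    have h2 : ∀ᶠ y : KnotComplement m n in 𝓝 x, coreCoord y ≠ 0 :=
      ContinuousAt.eventually_ne (by fun_prop) hx0.2
    filter_upwards [eventually_floor_eq hu hux, h1, h2] with y hy h1 h2
    rw [← hy, argTransition_eq hmn hab (angleNear_eq hc h1) (angleNear_eq hc' h2), chart, chart]
    group
  exact key.mono fun y hy => hy.trans key.self_of_nhds.symm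

include hm hn hmn in
theorem eventually_chart_mul_inv (hab : a ^ m = b ^ n) (i j : Bool × ℂ) (x : KnotComplement m n)
    (h : x ∈ chartDomain m n i ∩ chartDomain m n j) :
    ∀ᶠ y in 𝓝 x, chart m n a b j y * (chart m n a b i y)⁻¹ =
      chart m n a b j x * (chart m n a b i x)⁻¹ := by
  obtain ⟨h, h'⟩ := h
  match i, j, h, h' with
  | (true, c), (true, c'), h, h' =>
    filter_upwards [eventually_angleShift_sub_eq (f := fun y : KnotComplement m n => planeCoord y)
      (by fun_prop) h.2 h'.2] with y hy
    simp only [chart, ← zpow_sub, hy]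
  | (true, c), (false, c'), h, h' => exact eventually_chart_false_true hm hn hmn hab h h'
  | (false, c), (true, c'), h, h' =>
    filter_upwards [eventually_chart_false_true hm hn hmn hab h' h] with y hy
    simpa using congr_arg (·⁻¹) hy
  | (false, c), (false, c'), h, h' =>
    filter_upwards [eventually_angleShift_sub_eq (f := fun y : KnotComplement m n => coreCoord y)
      (by fun_prop) h.2 h'.2] with y hy
    simp only [chart, mul_inv_rev, inv_inv, mul_assoc, inv_mul_cancel_left, ← zpow_sub, hy]

include hm hn hmn in
/-- The homomorphism from the fundamental group of the complement of the knot that sends the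
standard generators to the inverses of `a` and `b`. -/
theorem exists_torusKnot_monodromy (hab : a ^ m = b ^ n) {x₀ : KnotComplement m n} {φ₀ θ₀ : ℝ}
    (hφ₀ : IsAngle (coreCoord x₀) φ₀) (hθ₀ : IsAngle (planeCoord x₀) θ₀)
    (hx₀ : x₀ ∈ coneRegion m n) (h0 : 0 ≤ n * θ₀ - m * φ₀) (h1 : n * θ₀ - m * φ₀ < 1) :
    ∃ M : FundamentalGroup (KnotComplement m n) x₀ →* G, ∀ γ : Path x₀ x₀,
      (InnerLift θ₀ 1 γ → M (loopClass γ) = a⁻¹) ∧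
      (OuterLift φ₀ θ₀ 1 0 γ → M (loopClass γ) = b⁻¹) := by
  obtain ⟨M, hM⟩ := exists_monodromy isOpen_chartDomain (exists_mem_chartDomain hm hn hmn)
    (eventually_chart_mul_inv hm hn hmn hab) x₀
  have hx := ne_zero_of_mem_offKnotCone hm hn hx₀
  obtain ⟨i, hi⟩ := hθ₀.exists_int hx.1 (isAngle_arg _)
  obtain ⟨j, hj⟩ := hφ₀.exists_int hx.2 (isAngle_arg _)
  have hT : argTransition m n a b x₀ = a ^ (-i) * b ^ j := by
    have := argTransition_eq hmn hab hi hj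
    rw [Int.floor_eq_zero_iff.2 ⟨h0, h1⟩, transition, mul_zero, mul_zero, zpow_zero, zpow_zero,
      mul_one] at this
    rw [← mul_right_inj (a ^ i), ← mul_left_inj (b ^ (-j)), ← this]
    group
  refine ⟨(MulAut.conj (a ^ i)).toMonoidHom.comp M, fun γ => ⟨?_, ?_⟩⟩
  · rintro ⟨θ, hθ, hθ0, hθ1, h⟩
    have hp : IsParallel (chartDomain m n) (chart m n a b) γ
        fun t => a ^ round ((planeCoord (γ t)).arg / (2 * π) - θ t) := fun t =>
      ⟨_, mem_chartDomain_true hm hn (h t).1, eventually_zpow_angleShift_mul a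
        (f := fun t => planeCoord (γ t)) (by fun_prop) hθ (fun s => (h s).2)
        (planeCoord_ne_zero_of_mem_innerRegion hm hn (h t).1)⟩
    have := hM γ _ hp
    rw [loopClass, MonoidHom.comp_apply, this, γ.source, γ.target, hθ0, hθ1, hi,
      sub_add_cancel_left, add_assoc, sub_add_cancel_left, ← Int.cast_add, ← Int.cast_neg, ← Int.cast_neg, round_intCast,
      round_intCast]
    simp only [MulEquiv.toMonoidHom_eq_coe, MonoidHom.coe_coe, MulAut.conj_apply]
    group
  · rintro ⟨φ, θ, hφ, hθ, hφ0, hφ1, hθ0, hθ1, h⟩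
    have hp : IsParallel (chartDomain m n) (chart m n a b) γ
        fun t => argTransition m n a b (γ t) *
          b ^ round ((coreCoord (γ t)).arg / (2 * π) - φ t) := fun t => by
      refine ⟨_, mem_chartDomain_false hm hn (h t).1.1, ?_⟩
      have := eventually_zpow_angleShift_mul b
        (f := fun t => coreCoord (γ t)) (t := t) (by fun_prop) hφ (fun s => (h s).2.1)
        (coreCoord_ne_zero_of_mem_outerRegion hm hn (h t).1.1)
      simpa only [chart, mul_assoc, inv_mul_cancel_left] using this
    have := hM γ _ hp
    rw [loopClass, MonoidHom.comp_apply, this, γ.source, γ.target, hφ0, hφ1, hj, hT,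
      sub_add_cancel_left, add_assoc, sub_add_cancel_left, ← Int.cast_add, ← Int.cast_neg, ← Int.cast_neg, round_intCast,
      round_intCast]
    simp only [MulEquiv.toMonoidHom_eq_coe, MonoidHom.coe_coe, MulAut.conj_apply]
    group

end Monodromy

theorem nonempty_mulEquiv_torusKnotGroup {P : Type*} [Group P] {m n : ℕ} {α β : P}
    (hαβ : α ^ m = β ^ n) (htop : Subgroup.closure {α, β} = ⊤)
    (hM : ∀ a b : TorusKnotGroup m n, a ^ m = b ^ n →
      ∃ M : P →* TorusKnotGroup m n, M α = a⁻¹ ∧ M β = b⁻¹) :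
    Nonempty (P ≃* TorusKnotGroup m n) := by
  let F : TorusKnotGroup m n →* P := PresentedGroup.toGroup
    (f := fun x => bif x then α⁻¹ else β⁻¹) (by simp [hαβ])
  have hF1 : F (.of true) = α⁻¹ := PresentedGroup.toGroup.of _
  have hF2 : F (.of false) = β⁻¹ := PresentedGroup.toGroup.of _
  have hrel : (.of true : TorusKnotGroup m n) ^ m = .of false ^ n :=
    PresentedGroup.mk_eq_mk_of_mul_inv_mem rfl
  obtain ⟨M, hM1, hM2⟩ := hM _ _ hrel
  have hMF : M.comp F = .id _ := PresentedGroup.ext fun x => by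
    cases x <;> simp [hF1, hF2, hM1, hM2]
  refine ⟨(MulEquiv.ofBijective F ⟨?_, ?_⟩).symm⟩
  · exact Function.LeftInverse.injective (g := M) fun x => DFunLike.congr_fun hMF x
  · rw [← MonoidHom.range_eq_top, eq_top_iff, ← htop, Subgroup.closure_le]
    rintro _ (rfl | rfl)
    · exact ⟨(.of true)⁻¹, by rw [map_inv, hF1, inv_inv]⟩
    · exact ⟨(.of false)⁻¹, by rw [map_inv, hF2, inv_inv]⟩

/-- For coprime positive integers `m, n` and the `(m, n)` torus knot
`K ⊆ ℝ³`, the fundamental group of `ℝ³ \ K` at any basepoint `x₀ ∈ ℝ³ \ K` is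
isomorphic to `⟨a, b | aᵐ = bⁿ⟩`. -/
theorem fundamentalGroup_torusKnot_complement (m n : ℕ) (hm : 0 < m) (hn : 0 < n)
    (hmn : Nat.gcd m n = 1) (x₀ : ℝ × ℝ × ℝ) (hx₀ : x₀ ∈ (torusKnot m n)ᶜ) :
    Nonempty (FundamentalGroup ((torusKnot m n)ᶜ : Set (ℝ × ℝ × ℝ)) ⟨x₀, hx₀⟩ ≃*
      TorusKnotGroup m n) := by
  have := pathConnectedSpace_knotComplement hm.ne' hn.ne' hmn
  obtain ⟨x₁, φ₁, θ₁, γ, γ', hφ, hθ, hx₁, h, hγ, hγ', hrel, htop⟩ :=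
    exists_generators hm.ne' hn.ne' hmn
  obtain ⟨e⟩ := nonempty_mulEquiv_torusKnotGroup hrel htop fun a b hab => by
    obtain ⟨M, hM⟩ := exists_torusKnot_monodromy hm.ne' hn.ne' hmn hab hφ hθ hx₁
      (by rw [h]; norm_num) (by rw [h]; norm_num)
    exact ⟨M, (hM γ).1 hγ, (hM γ').2 hγ'⟩
  exact ⟨(FundamentalGroup.fundamentalGroupMulEquivOfPathConnected _ _).trans e⟩
end

section
/- Let m, n be integers with m, n > 1. The quotient of the presented group G_{m,n} = ⟨a, b | aᵐ = bⁿ⟩ by the (necessarily normal) subgroup C generated by the central element aᵐ is isomorphic to the free product ℤ_m ∗ ℤ_n. -/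
/-- The homomorphism from the cyclic group `ℤ/k` sending the generator to `g`, where `g ^ k = 1`. -/
def zmodPowersHom {G : Type*} [Group G] {k : ℕ} (g : G) (hg : g ^ k = 1) :
    Multiplicative (ZMod k) →* G :=
  AddMonoidHom.toMultiplicativeLeft
    (ZMod.lift k ⟨zmultiplesHom (Additive G) (Additive.ofMul g), by
      simpa [← ofMul_pow] using hg⟩)

@[simp]
theorem zmodPowersHom_ofAdd_one {G : Type*} [Group G] {k : ℕ} (g : G) (hg : g ^ k = 1) :
    zmodPowersHom g hg (Multiplicative.ofAdd 1) = g := by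
  have h := ZMod.lift_coe k ⟨zmultiplesHom (Additive G) (Additive.ofMul g), by
      simpa [← ofMul_pow] using hg⟩ 1
  simp only [Int.cast_one, zmultiplesHom_apply, one_zsmul] at h
  exact h

theorem MonoidHom.map_ofAdd_one_pow_zmod {M : Type*} [Monoid M] {k : ℕ}
    (f : Multiplicative (ZMod k) →* M) : f (Multiplicative.ofAdd 1) ^ k = 1 := by
  have h : Multiplicative.ofAdd (1 : ZMod k) ^ k = 1 := by
    rw [← ofAdd_nsmul, nsmul_one, ZMod.natCast_self, ofAdd_zero]
  rw [← map_pow f, h, map_one]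

theorem MonoidHom.ext_multiplicative_zmod {G : Type*} [Group G] {k : ℕ}
    {f g : Multiplicative (ZMod k) →* G}
    (h : f (Multiplicative.ofAdd 1) = g (Multiplicative.ofAdd 1)) : f = g := by
  refine MonoidHom.ext fun x ↦ ?_
  obtain ⟨z, hz⟩ := ZMod.intCast_surjective x.toAdd
  have hx : x = Multiplicative.ofAdd (1 : ZMod k) ^ z := by
    rw [← ofAdd_zsmul, zsmul_one, hz, ofAdd_toAdd]
  rw [hx, map_zpow, map_zpow, h]

theorem TorusKnotGroup.of_pow_eq (m n : ℕ) :
    (PresentedGroup.of true : TorusKnotGroup m n) ^ m = PresentedGroup.of false ^ n := by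
  have h : PresentedGroup.mk {FreeGroup.of true ^ m * (FreeGroup.of false ^ n)⁻¹}
      (FreeGroup.of true ^ m * (FreeGroup.of false ^ n)⁻¹) = 1 :=
    PresentedGroup.one_of_mem rfl
  rw [map_mul, map_inv, map_pow, map_pow] at h
  exact mul_inv_eq_one.mp h

/-- The homomorphism `⟨a, b | aᵐ = bⁿ⟩ → ℤ/m ∗ ℤ/n` sending `a` and `b` to the generators. -/
def TorusKnotGroup.toCoprod (m n : ℕ) :
    TorusKnotGroup m n →*
      Monoid.Coprod (Multiplicative (ZMod m)) (Multiplicative (ZMod n)) :=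
  PresentedGroup.toGroup
    (f := fun i ↦ cond i (Monoid.Coprod.inl (Multiplicative.ofAdd 1))
      (Monoid.Coprod.inr (Multiplicative.ofAdd 1))) (by
    rintro r rfl
    rw [map_mul, map_inv, map_pow, map_pow, FreeGroup.lift_apply_of, FreeGroup.lift_apply_of,
      cond_true, cond_false, MonoidHom.map_ofAdd_one_pow_zmod,
      MonoidHom.map_ofAdd_one_pow_zmod, inv_one, mul_one])

@[simp]
theorem TorusKnotGroup.toCoprod_of_true (m n : ℕ) :
    toCoprod m n (PresentedGroup.of true) = Monoid.Coprod.inl (Multiplicative.ofAdd 1) :=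
  PresentedGroup.toGroup.of _

@[simp]
theorem TorusKnotGroup.toCoprod_of_false (m n : ℕ) :
    toCoprod m n (PresentedGroup.of false) = Monoid.Coprod.inr (Multiplicative.ofAdd 1) :=
  PresentedGroup.toGroup.of _

/-- For `m, n > 1`, the quotient of `G_{m,n} = ⟨a, b | aᵐ = bⁿ⟩` by
the (necessarily normal) subgroup `C` generated by the central element `aᵐ` is
isomorphic to the free product `ℤ_m ∗ ℤ_n`. -/
theorem torusKnotGroup_quotient_center_iso (m n : ℕ) (hm : 1 < m) (hn : 1 < n)
    (C : Subgroup (TorusKnotGroup m n))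
    (hC : C = Subgroup.zpowers ((PresentedGroup.of true : TorusKnotGroup m n) ^ m))
    [C.Normal] :
    Nonempty ((TorusKnotGroup m n ⧸ C) ≃*
      Monoid.Coprod (Multiplicative (ZMod m)) (Multiplicative (ZMod n))) := by
  have hmem : (PresentedGroup.of true : TorusKnotGroup m n) ^ m ∈ C :=
    hC ▸ Subgroup.mem_zpowers _
  have ha : (QuotientGroup.mk' C (PresentedGroup.of true)) ^ m = 1 := by
    rw [← map_pow]
    exact (QuotientGroup.eq_one_iff _).mpr hmem
  have hb : (QuotientGroup.mk' C (PresentedGroup.of false)) ^ n = 1 := by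
    rw [← map_pow, ← TorusKnotGroup.of_pow_eq]
    exact (QuotientGroup.eq_one_iff _).mpr hmem
  have hker : C ≤ (TorusKnotGroup.toCoprod m n).ker := by
    rw [hC, Subgroup.zpowers_le, MonoidHom.mem_ker, map_pow, TorusKnotGroup.toCoprod_of_true,
      MonoidHom.map_ofAdd_one_pow_zmod]
  refine ⟨MonoidHom.toMulEquiv (QuotientGroup.lift C (TorusKnotGroup.toCoprod m n) hker)
    (Monoid.Coprod.lift (zmodPowersHom _ ha) (zmodPowersHom _ hb)) ?_ ?_⟩
  · refine QuotientGroup.monoidHom_ext _ (PresentedGroup.ext fun i ↦ ?_)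
    cases i <;> simp
  · refine Monoid.Coprod.hom_ext (MonoidHom.ext_multiplicative_zmod ?_)
      (MonoidHom.ext_multiplicative_zmod ?_) <;> simp
end

section
/- Let m, n be integers with m, n > 1. The center of the presented group G_{m,n} = ⟨a, b | aᵐ = bⁿ⟩ is exactly the cyclic subgroup C generated by the element aᵐ (equivalently, by bⁿ). -/
/-- A free product of at least two nontrivial groups has trivial center. -/
theorem Monoid.CoprodI.center_eq_bot {ι : Type*} [Nontrivial ι] (A : ι → Type*)
    [∀ i, Group (A i)] [∀ i, Nontrivial (A i)] :
    Subgroup.center (Monoid.CoprodI A) = ⊥ := by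
  classical
  rw [eq_bot_iff]
  intro c hc
  rw [Subgroup.mem_bot]
  obtain ⟨w, rfl⟩ := (Word.equiv (M := A)).symm.surjective c
  change w.prod ∈ _ at hc
  change w.prod = 1
  by_cases hw : w = Word.empty
  · rw [hw, Word.prod_empty]
  exfalso
  obtain ⟨i, j, v, rfl⟩ := NeWord.of_word w hw
  obtain ⟨k, hk⟩ := exists_ne j
  obtain ⟨x, hx⟩ := exists_ne (1 : A k)
  let s := NeWord.singleton x hx
  let u := NeWord.append (NeWord.append v hk.symm s) hk v.inv
  have hu : u.toWord.prod = s.toWord.prod := by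
    change u.prod = s.prod
    change v.prod ∈ _ at hc
    simp only [u, s, NeWord.append_prod, NeWord.inv_prod, NeWord.prod_singleton]
    rw [← Subgroup.mem_center_iff.mp hc, mul_inv_cancel_right]
  have h := congrArg (fun t : Word A => t.toList.length) (Word.equiv.symm.injective (show
    Word.equiv.symm u.toWord = Word.equiv.symm s.toWord from hu))
  have hv := List.length_pos_of_ne_nil v.toList_ne_nil
  simp [u, s, NeWord.toWord, NeWord.toList] at h
  omega

namespace TorusKnotGroup

theorem of_true_pow_eq_of_false_pow (m n : ℕ) :
    (PresentedGroup.of true : TorusKnotGroup m n) ^ m = PresentedGroup.of false ^ n := by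
  rw [← mul_inv_eq_one]
  exact PresentedGroup.one_of_mem (Set.mem_singleton _)

theorem of_pow (m n : ℕ) (b : Bool) :
    (PresentedGroup.of b : TorusKnotGroup m n) ^ cond b m n = PresentedGroup.of true ^ m := by
  cases b
  · exact (of_true_pow_eq_of_false_pow m n).symm
  · rfl

theorem of_true_pow_mem_center (m n : ℕ) :
    (PresentedGroup.of true : TorusKnotGroup m n) ^ m ∈
      Subgroup.center (TorusKnotGroup m n) := by
  rw [← Subgroup.centralizer_univ, ← Subgroup.coe_top, ← PresentedGroup.closure_range_of,
    Subgroup.centralizer_closure, Subgroup.mem_centralizer_iff]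
  rintro _ ⟨b, rfl⟩
  rw [← of_pow m n b]
  exact (Commute.self_pow _ _).eq

/-- The projection of `G_{m,n}` onto the free product of cyclic groups of orders `m` and `n`. -/
def toCoprodI (m n : ℕ) :
    TorusKnotGroup m n →* Monoid.CoprodI fun b : Bool => Multiplicative (ZMod (cond b m n)) :=
  PresentedGroup.toGroup
    (f := fun b => Monoid.CoprodI.of (i := b) (Multiplicative.ofAdd (1 : ZMod (cond b m n)))) <| by
    rintro _ rfl
    have h (b : Bool) : Monoid.CoprodI.of (M := fun b => Multiplicative (ZMod (cond b m n)))
        (i := b) (Multiplicative.ofAdd (1 : ZMod (cond b m n))) ^ cond b m n = 1 := by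
      rw [← MonoidHom.map_pow, ← ofAdd_nsmul, nsmul_one, ZMod.natCast_self, ofAdd_zero, map_one]
    rw [map_mul, map_inv, map_pow, map_pow, FreeGroup.lift_apply_of, FreeGroup.lift_apply_of]
    exact mul_inv_eq_one.mpr ((h true).trans (h false).symm)

theorem toCoprodI_of (m n : ℕ) (b : Bool) :
    toCoprodI m n (PresentedGroup.of b) =
      Monoid.CoprodI.of (i := b) (Multiplicative.ofAdd (1 : ZMod (cond b m n))) :=
  PresentedGroup.toGroup.of _

theorem toCoprodI_surjective (m n : ℕ) : Function.Surjective (toCoprodI m n) := by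
  rw [← MonoidHom.range_eq_top, eq_top_iff]
  have h := Monoid.CoprodI.lift_range_le
    (G := fun b : Bool => Multiplicative (ZMod (cond b m n))) (fun b =>
      Monoid.CoprodI.of (M := fun b => Multiplicative (ZMod (cond b m n))) (i := b))
    (s := (toCoprodI m n).range) ?_
  · rwa [Monoid.CoprodI.lift_of', MonoidHom.range_eq_top.mpr Function.surjective_id] at h
  · rintro b _ ⟨x, rfl⟩
    obtain ⟨k, hk⟩ := ZMod.intCast_surjective x.toAdd
    refine ⟨PresentedGroup.of b ^ k, ?_⟩
    rw [map_zpow, toCoprodI_of, ← map_zpow, ← ofAdd_zsmul, zsmul_one, hk, ofAdd_toAdd]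

theorem ker_toCoprodI_le (m n : ℕ) :
    (toCoprodI m n).ker ≤
      Subgroup.zpowers ((PresentedGroup.of true : TorusKnotGroup m n) ^ m) := by
  set C := Subgroup.zpowers ((PresentedGroup.of true : TorusKnotGroup m n) ^ m) with hC
  have hle : C ≤ Subgroup.center _ := Subgroup.zpowers_le.mpr (of_true_pow_mem_center m n)
  have : C.Normal := ⟨fun x hx y => by
    rwa [Subgroup.mem_center_iff.mp (hle hx) y, mul_inv_cancel_right]⟩
  let g (b : Bool) : TorusKnotGroup m n ⧸ C := QuotientGroup.mk (PresentedGroup.of b)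
  have hg (b : Bool) : g b ^ cond b m n = 1 := by
    rw [← QuotientGroup.mk_pow, of_pow, QuotientGroup.eq_one_iff]
    exact Subgroup.mem_zpowers _
  let p (b : Bool) : Multiplicative (ZMod (cond b m n)) →* TorusKnotGroup m n ⧸ C :=
    AddMonoidHom.toMultiplicativeLeft (ZMod.lift (cond b m n)
      ⟨zmultiplesHom (Additive (TorusKnotGroup m n ⧸ C)) (Additive.ofMul (g b)), by
        simpa [← ofMul_pow] using hg b⟩)
  have hp (b : Bool) : p b (Multiplicative.ofAdd 1) = g b := by
    have := ZMod.lift_coe (cond b m n)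
      ⟨zmultiplesHom (Additive (TorusKnotGroup m n ⧸ C)) (Additive.ofMul (g b)), by
        simpa [← ofMul_pow] using hg b⟩ 1
    simp only [Int.cast_one, zmultiplesHom_apply, one_zsmul] at this
    exact congrArg Additive.toMul this
  have hcomp : (Monoid.CoprodI.lift p).comp (toCoprodI m n) = QuotientGroup.mk' C := by
    refine PresentedGroup.ext fun b => ?_
    rw [MonoidHom.comp_apply, toCoprodI_of, Monoid.CoprodI.lift_of, hp]
    rfl
  intro x hx
  rw [← QuotientGroup.eq_one_iff, ← QuotientGroup.mk'_apply, ← hcomp, MonoidHom.comp_apply,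
    MonoidHom.mem_ker.mp hx, map_one]

end TorusKnotGroup

/-- For `m, n > 1`, the center of `G_{m,n} = ⟨a, b | aᵐ = bⁿ⟩` is
exactly the cyclic subgroup generated by `aᵐ`. -/
theorem center_torusKnotGroup (m n : ℕ) (hm : 1 < m) (hn : 1 < n) :
    Subgroup.center (TorusKnotGroup m n) =
      Subgroup.zpowers ((PresentedGroup.of true : TorusKnotGroup m n) ^ m) := by
  apply le_antisymm
  · have (b : Bool) : Nontrivial (Multiplicative (ZMod (cond b m n))) := by
      have : Fact (1 < cond b m n) := ⟨by cases b <;> assumption⟩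
      infer_instance
    refine le_trans (fun z hz => ?_) (TorusKnotGroup.ker_toCoprodI_le m n)
    rw [MonoidHom.mem_ker, ← Subgroup.mem_bot, ← Monoid.CoprodI.center_eq_bot,
      Subgroup.mem_center_iff]
    intro y
    obtain ⟨x, rfl⟩ := TorusKnotGroup.toCoprodI_surjective m n y
    rw [← map_mul, ← map_mul, Subgroup.mem_center_iff.mp hz]
  · exact Subgroup.zpowers_le.mpr (TorusKnotGroup.of_true_pow_mem_center m n)
end

section
/- Let m, n be positive integers. Every element of finite order in the free product ℤ_m ∗ ℤ_n has order dividing m or dividing n. -/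
namespace Monoid.CoprodI

variable {ι : Type*} {G : ι → Type*}

/-- A nonempty reduced word whose first and last letters lie in different factors represents an
element of infinite order. -/
theorem Word.not_isOfFinOrder_prod [∀ i, Monoid (G i)] (w : Word G) (hw : w.toList ≠ [])
    (h : ∀ x ∈ w.toList.getLast?, ∀ y ∈ w.toList.head?, x.1 ≠ y.1) :
    ¬ IsOfFinOrder w.prod := by
  classical
  rw [isOfFinOrder_iff_pow_eq_one]
  rintro ⟨n, hn, hpow⟩
  let v : Word G :=
    { toList := (List.replicate n w.toList).flatten
      ne_one := by
        intro l hl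
        obtain ⟨l', hl', hmem⟩ := List.mem_flatten.1 hl
        rw [List.eq_of_mem_replicate hl'] at hmem
        exact w.ne_one l hmem
      chain_ne := by
        rw [List.isChain_flatten fun hmem => hw (List.eq_of_mem_replicate hmem).symm]
        refine ⟨fun l hl => ?_, List.isChain_replicate_of_rel n h⟩
        rw [List.eq_of_mem_replicate hl]
        exact w.chain_ne }
  have hv : v.prod = 1 := by
    simpa [v, Word.prod, List.map_flatten, List.prod_flatten] using hpow
  have hv_empty : v = Word.empty := Word.equiv.symm.injective (hv.trans Word.prod_empty.symm)
  have hnil : (List.replicate n w.toList).flatten = [] := congrArg Word.toList hv_empty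
  rw [List.flatten_eq_nil_iff] at hnil
  exact hw (hnil _ (List.mem_replicate.2 ⟨hn.ne', rfl⟩))

variable [∀ i, Group (G i)]

/-- The value of a nonempty word of finite order is conjugate into one of the factors. -/
theorem Word.exists_isConj_of_isOfFinOrder (w : Word G) (hw : w.toList ≠ [])
    (hfin : IsOfFinOrder w.prod) : ∃ (i : ι) (x : G i), IsConj (of x) w.prod := by
  induction hlen : w.toList.length using Nat.strong_induction_on generalizing w with
  | _ N ih =>
  obtain ⟨l, hone, hchain⟩ := w
  obtain _ | ⟨⟨i, a⟩, l⟩ := l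
  · exact absurd rfl hw
  obtain rfl | ⟨l, ⟨j, b⟩, rfl⟩ := List.eq_nil_or_concat' l
  · exact ⟨i, a, by simp [Word.prod, IsConj.refl, -isConj_iff]⟩
  by_cases hij : j = i
  swap
  · refine absurd hfin (Word.not_isOfFinOrder_prod _ hw ?_)
    intro x hx y hy
    simp only [← List.cons_append, List.getLast?_concat, Option.mem_some_iff] at hx
    simp only [List.head?_cons, Option.mem_some_iff] at hy
    subst hx hy
    exact hij
  subst hij
  have hchain_init : (⟨j, a⟩ :: l : List (Σ i, G i)).IsChain (fun x y => x.1 ≠ y.1) :=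
    (List.isChain_append.1 (by simpa using hchain)).1
  have hone_mid : ∀ x ∈ l, x.2 ≠ 1 := fun x hx => hone x (by simp [hx])
  have hconj : IsConj (of (b * a) * (l.map fun x => of x.2).prod)
      (Word.prod ⟨⟨j, a⟩ :: (l ++ [⟨j, b⟩]), hone, hchain⟩) := by
    rw [isConj_iff]
    exact ⟨(of b)⁻¹, by simp [Word.prod, mul_assoc]⟩
  have hreduce : ∀ v : Word G, v.toList ≠ [] → v.toList.length < N →
      v.prod = of (b * a) * (l.map fun x => of x.2).prod → ∃ (i : ι) (x : G i),
        IsConj (of x) (Word.prod ⟨⟨j, a⟩ :: (l ++ [⟨j, b⟩]), hone, hchain⟩) := by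
    intro v hv hvlen hprod
    rw [← hprod] at hconj
    obtain ⟨k, x, hx⟩ := ih _ hvlen v hv (hconj.symm.isOfFinOrder hfin) rfl
    exact ⟨k, x, hx.trans hconj⟩
  simp only [List.length_cons, List.length_append, List.length_nil] at hlen
  by_cases hba : b * a = 1
  · by_cases hl : l = []
    · subst hl
      exact ⟨j, b * a, by simpa using hconj⟩
    · exact hreduce ⟨l, hone_mid, hchain_init.tail⟩ hl (by simp only; omega)
        (by simp [Word.prod, hba])
  · refine hreduce ⟨⟨j, b * a⟩ :: l, ?_, ?_⟩ (by simp)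
      (by simp only [List.length_cons]; omega) (by simp [Word.prod])
    · simpa [hba] using hone_mid
    · rw [List.isChain_cons] at hchain_init ⊢
      exact hchain_init

/-- An element of finite order in a free product is trivial or conjugate into one of the
factors. -/
theorem eq_one_or_exists_isConj_of_isOfFinOrder {g : CoprodI G} (hg : IsOfFinOrder g) :
    g = 1 ∨ ∃ (i : ι) (x : G i), IsConj (of x) g := by
  classical
  obtain ⟨w, rfl⟩ : ∃ w : Word G, w.prod = g := Word.equiv.symm.surjective g
  by_cases hw : w.toList = []
  · left
    simp [Word.prod, hw]
  · exact .inr (w.exists_isConj_of_isOfFinOrder hw hg)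

end Monoid.CoprodI

/-- Every element of finite order in the free product `ℤ_m ∗ ℤ_n`
has order dividing `m` or dividing `n`. -/
theorem orderOf_coprod_zmod_dvd (m n : ℕ) (hm : 0 < m) (hn : 0 < n)
    (g : Monoid.Coprod (Multiplicative (ZMod m)) (Multiplicative (ZMod n)))
    (hg : IsOfFinOrder g) :
    orderOf g ∣ m ∨ orderOf g ∣ n := by
  have pow_card (k : ℕ) (x : Multiplicative (ZMod k)) : x ^ k = 1 :=
    Multiplicative.toAdd.injective (by simp)
  let k : Bool → ℕ := fun b => cond b m n
  let M : Bool → Type := fun b => Multiplicative (ZMod (k b))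
  let toI : Monoid.Coprod (Multiplicative (ZMod m)) (Multiplicative (ZMod n)) →*
      Monoid.CoprodI M :=
    Monoid.Coprod.lift (Monoid.CoprodI.of (M := M) (i := true))
      (Monoid.CoprodI.of (M := M) (i := false))
  let incl : ∀ b, M b →* Monoid.Coprod (Multiplicative (ZMod m)) (Multiplicative (ZMod n))
    | true => Monoid.Coprod.inl
    | false => Monoid.Coprod.inr
  let ofI := Monoid.CoprodI.lift incl
  have hleft : ofI.comp toI = MonoidHom.id _ := by
    apply Monoid.Coprod.hom_ext
    · exact MonoidHom.ext (Monoid.CoprodI.lift_of incl (i := true))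
    · exact MonoidHom.ext (Monoid.CoprodI.lift_of incl (i := false))
  have hg_eq : ofI (toI g) = g := DFunLike.congr_fun hleft g
  rcases Monoid.CoprodI.eq_one_or_exists_isConj_of_isOfFinOrder (toI.isOfFinOrder hg) with
    h | ⟨b, x, hx⟩
  · rw [h, map_one] at hg_eq
    simp [← hg_eq]
  · have hconj := ofI.map_isConj hx
    rw [hg_eq, Monoid.CoprodI.lift_of] at hconj
    obtain ⟨c, hc⟩ := isConj_iff.1 hconj
    have hpow : g ^ k b = 1 := by
      rw [← hc, conj_pow, ← map_pow, pow_card (k b) x]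
      simp
    cases b
    · exact .inr (orderOf_dvd_of_pow_eq_one hpow)
    · exact .inl (orderOf_dvd_of_pow_eq_one hpow)
end

section
/- Let m, n, p, q be integers, all greater than 1. If the free products ℤ_m ∗ ℤ_n and ℤ_p ∗ ℤ_q are isomorphic as groups, then m·n = p·q. -/
/-- The abelianization of a free product of commutative groups is their direct product. -/
def abelianizationCoprodEquiv (A B : Type*) [CommGroup A] [CommGroup B] :
    Abelianization (Monoid.Coprod A B) ≃* A × B :=
  MonoidHom.toMulEquiv
    (Abelianization.lift Monoid.Coprod.toProd)
    (MonoidHom.coprod (Abelianization.of.comp Monoid.Coprod.inl)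
      (Abelianization.of.comp Monoid.Coprod.inr))
    (by
      apply Abelianization.hom_ext
      apply Monoid.Coprod.hom_ext <;> ext x <;> simp)
    (by ext x <;> simp)

theorem card_abelianization_coprod_zmod (m n : ℕ) :
    Nat.card (Abelianization
      (Monoid.Coprod (Multiplicative (ZMod m)) (Multiplicative (ZMod n)))) = m * n := by
  rw [Nat.card_congr (abelianizationCoprodEquiv _ _).toEquiv, Nat.card_prod,
    Nat.card_congr Multiplicative.toAdd, Nat.card_congr Multiplicative.toAdd,
    Nat.card_zmod, Nat.card_zmod]

/-- For integers `m, n, p, q > 1`, if `ℤ_m ∗ ℤ_n ≅ ℤ_p ∗ ℤ_q`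
as groups, then `m * n = p * q`. -/
theorem coprod_zmod_iso_imp_mul_eq (m n p q : ℕ)
    (hm : 1 < m) (hn : 1 < n) (hp : 1 < p) (hq : 1 < q)
    (h : Nonempty (Monoid.Coprod (Multiplicative (ZMod m)) (Multiplicative (ZMod n)) ≃*
      Monoid.Coprod (Multiplicative (ZMod p)) (Multiplicative (ZMod q)))) :
    m * n = p * q := by
  obtain ⟨e⟩ := h
  rw [← card_abelianization_coprod_zmod m n, ← card_abelianization_coprod_zmod p q]
  exact Nat.card_congr e.abelianizationCongr.toEquiv
end

section
/- Let m, n, p, q be integers with m ≥ n > 1 and p ≥ q > 1. If the free products ℤ_m ∗ ℤ_n and ℤ_p ∗ ℤ_q are isomorphic as groups, then m = p and n = q. -/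
open Multiplicative in
/-- Homomorphisms out of the cyclic group of order `n` are the solutions of `x ^ n = 1`. -/
def zmodHomEquivPowEqOne (n : ℕ) (K : Type*) [Group K] :
    (Multiplicative (ZMod n) →* K) ≃ {x : K // x ^ n = 1} :=
  MonoidHom.toAdditiveRight.trans <| (ZMod.lift n).symm.trans <|
    ((zmultiplesHom (Additive K)).symm.trans Additive.toMul).subtypeEquiv fun f => by
      obtain ⟨x, rfl⟩ := (zmultiplesHom (Additive K)).surjective f
      simp [← toMul_nsmul]

theorem card_coprod_zmod_hom (m n : ℕ) (K : Type*) [Group K] :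
    Nat.card (Monoid.Coprod (Multiplicative (ZMod m)) (Multiplicative (ZMod n)) →* K) =
      Nat.card {x : K // x ^ m = 1} * Nat.card {x : K // x ^ n = 1} := by
  rw [← Nat.card_congr Monoid.Coprod.liftEquiv, Nat.card_prod,
    Nat.card_congr (zmodHomEquivPowEqOne m K), Nat.card_congr (zmodHomEquivPowEqOne n K)]

/-- The affine group `x ↦ a * x + b` of the line over `F`. -/
abbrev LineAffineGroup (F : Type*) [Field F] : Type _ :=
  Multiplicative F ⋊[(MulAutMultiplicative (G := F)).symm.toMonoidHom.comp
    (DistribMulAction.toAddAut Fˣ F)] Fˣ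

namespace LineAffineGroup

variable {F : Type*} [Field F]

theorem right_pow (x : LineAffineGroup F) (k : ℕ) : (x ^ k).right = x.right ^ k :=
  map_pow SemidirectProduct.rightHom x k

theorem toAdd_left_pow (x : LineAffineGroup F) (k : ℕ) :
    (x ^ k).left.toAdd = x.left.toAdd * ∑ i ∈ Finset.range k, (x.right : F) ^ i := by
  induction k with
  | zero => simp
  | succ k ih =>
    rw [pow_succ, SemidirectProduct.mul_left, toAdd_mul, ih, Finset.sum_range_succ, mul_add,
      right_pow]
    congr 1
    change ((x.right ^ k : Fˣ) : F) * x.left.toAdd = _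
    rw [Units.val_pow_eq_pow_val, mul_comm]

theorem pow_eq_one_iff (x : LineAffineGroup F) (k : ℕ) :
    x ^ k = 1 ↔ x.right ^ k = 1 ∧
      x.left.toAdd * ∑ i ∈ Finset.range k, (x.right : F) ^ i = 0 := by
  rw [SemidirectProduct.ext_iff, right_pow, ← toAdd_left_pow, and_comm]
  simp

/-- Solutions of `x ^ m = 1` in the affine group, fibred over their linear parts. -/
def powEqOneEquiv (F : Type*) [Field F] (m : ℕ) :
    {x : LineAffineGroup F // x ^ m = 1} ≃
      Σ a : (powMonoidHom m : Fˣ →* Fˣ).ker,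
        {b : F // b * ∑ i ∈ Finset.range m, ((a : Fˣ) : F) ^ i = 0} where
  toFun x := ⟨⟨x.1.right, ((pow_eq_one_iff _ _).1 x.2).1⟩,
    ⟨x.1.left.toAdd, ((pow_eq_one_iff _ _).1 x.2).2⟩⟩
  invFun y := ⟨⟨Multiplicative.ofAdd y.2.1, y.1.1⟩, (pow_eq_one_iff _ _).2 ⟨y.1.2, y.2.2⟩⟩
  left_inv _ := rfl
  right_inv _ := rfl

theorem card_pow_eq_one [Finite F] {m : ℕ} (hm : m ∣ Nat.card F - 1) (hm0 : (m : F) ≠ 0) :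
    Nat.card {x : LineAffineGroup F // x ^ m = 1} = 1 + Nat.card F * (m - 1) := by
  classical
  have := Fintype.ofFinite F
  have hker : Nat.card (powMonoidHom m : Fˣ →* Fˣ).ker = m := by
    rw [IsCyclic.card_powMonoidHom_ker, Nat.card_units, Nat.gcd_eq_right hm]
  have hfib (a : (powMonoidHom m : Fˣ →* Fˣ).ker) :
      Nat.card {b : F // b * ∑ i ∈ Finset.range m, ((a : Fˣ) : F) ^ i = 0} =
        if a = 1 then 1 else Nat.card F := by
    split_ifs with ha
    · simp [ha, hm0]
    · have ha1 : ((a : Fˣ) : F) - 1 ≠ 0 := by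
        rw [sub_ne_zero]
        simpa using ha
      have ham : ((a : Fˣ) : F) ^ m = 1 := by
        have h : (a : Fˣ) ^ m = 1 := a.2
        rw [← Units.val_pow_eq_pow_val, h, Units.val_one]
      have hsum : ∑ i ∈ Finset.range m, ((a : Fˣ) : F) ^ i = 0 := by
        simpa [ham, ha1] using geom_sum_mul ((a : Fˣ) : F) m
      simp [hsum]
  rw [Nat.card_congr (powEqOneEquiv F m), Nat.card_sigma, Finset.sum_congr rfl fun a _ => hfib a,
    ← Finset.add_sum_erase _ _ (Finset.mem_univ 1), if_pos rfl,
    Finset.sum_congr rfl fun a ha => if_neg (Finset.ne_of_mem_erase ha), Finset.sum_const,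
    Finset.card_erase_of_mem (Finset.mem_univ _), Finset.card_univ, ← Nat.card_eq_fintype_card,
    hker, smul_eq_mul, mul_comm]

end LineAffineGroup

/-- For integers `m ≥ n > 1` and `p ≥ q > 1`, if
`ℤ_m ∗ ℤ_n ≅ ℤ_p ∗ ℤ_q` as groups, then `m = p` and `n = q`. -/
theorem coprod_zmod_iso_imp_eq (m n p q : ℕ)
    (hn : 1 < n) (hnm : n ≤ m) (hq : 1 < q) (hqp : q ≤ p)
    (h : Nonempty (Monoid.Coprod (Multiplicative (ZMod m)) (Multiplicative (ZMod n)) ≃*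
      Monoid.Coprod (Multiplicative (ZMod p)) (Multiplicative (ZMod q)))) :
    m = p ∧ n = q := by
  obtain ⟨e⟩ := h
  have hk : m * n * (p * q) ≠ 0 := by
    have : 0 < m := by omega
    have : 0 < p := by omega
    positivity
  obtain ⟨l, hl, hlt, hmod⟩ := Nat.exists_prime_gt_modEq_one (m + n + p + q) hk
  have : Fact l.Prime := ⟨hl⟩
  have hdvd : m * n * (p * q) ∣ l - 1 := (Nat.modEq_iff_dvd' hl.one_le).1 hmod.symm
  have hcard {d : ℕ} (hd : d ∣ m * n * (p * q)) (hd1 : 1 < d) (hdl : d < l) :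
      Nat.card {x : LineAffineGroup (ZMod l) // x ^ d = 1} = 1 + l * (d - 1) := by
    have := LineAffineGroup.card_pow_eq_one (F := ZMod l) (m := d)
      (by simpa using hd.trans hdvd)
      (by
        rw [Ne, ZMod.natCast_eq_zero_iff]
        exact Nat.not_dvd_of_pos_of_lt (by omega) hdl)
    simpa using this
  have key := Nat.card_congr (e.monoidHomCongrLeftEquiv (N := LineAffineGroup (ZMod l)))
  rw [card_coprod_zmod_hom, card_coprod_zmod_hom,
    hcard ⟨n * (p * q), by ring⟩ (by omega) (by omega),
    hcard ⟨m * (p * q), by ring⟩ (by omega) (by omega),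
    hcard ⟨m * n * q, by ring⟩ (by omega) (by omega),
    hcard ⟨m * n * p, by ring⟩ (by omega) (by omega)] at key
  obtain ⟨a, rfl⟩ := Nat.exists_eq_add_of_le' (show 1 ≤ m by omega)
  obtain ⟨b, rfl⟩ := Nat.exists_eq_add_of_le' hn.le
  obtain ⟨c, rfl⟩ := Nat.exists_eq_add_of_le' (show 1 ≤ p by omega)
  obtain ⟨d, rfl⟩ := Nat.exists_eq_add_of_le' hq.le
  simp only [Nat.add_sub_cancel] at key
  have hdiv : a + b + l * (a * b) = c + d + l * (c * d) :=
    Nat.eq_of_mul_eq_mul_left hl.pos (by linarith)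
  have hsum : a + b = c + d := by
    have := congrArg (· % l) hdiv
    simpa [Nat.add_mul_mod_self_left, Nat.mod_eq_of_lt (show a + b < l by omega),
      Nat.mod_eq_of_lt (show c + d < l by omega)] using this
  have hprod : a * b = c * d := Nat.eq_of_mul_eq_mul_left hl.pos (by omega)
  have hac : (a - c : ℤ) * (a - d) = 0 := by
    zify at hsum hprod
    linear_combination a * hsum - hprod
  rcases mul_eq_zero.1 hac with h | h <;> omega
end

section
/- Let m, n, p, q be integers with m ≥ n > 1 and p ≥ q > 1. If the presented groups G_{m,n} = ⟨a, b | aᵐ = bⁿ⟩ and G_{p,q} = ⟨a, b | aᵖ = b^q⟩ are isomorphic as groups, then m = p and n = q. In other words, the integers m, n > 1 are uniquely determined by the group G_{m,n}. -/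
/-- The group of affine transformations `z ↦ u z + α` of the complex line. -/
abbrev ComplexAffineGroup : Type :=
  Multiplicative ℂ
    ⋊[(MulAutMultiplicative ℂ).symm.toMonoidHom.comp (DistribMulAction.toAddAut ℂˣ ℂ)] ℂˣ

namespace ComplexAffineGroup

theorem mul_comm_iff (x y : ComplexAffineGroup) :
    x * y = y * x ↔
      (1 - (y.right : ℂ)) * x.left.toAdd = (1 - (x.right : ℂ)) * y.left.toAdd := by
  rw [SemidirectProduct.ext_iff, ← Multiplicative.toAdd.injective.eq_iff]
  simp only [SemidirectProduct.mul_left, SemidirectProduct.mul_right, toAdd_mul,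
    mul_comm x.right y.right, and_true]
  change x.left.toAdd + (x.right : ℂ) * y.left.toAdd =
    y.left.toAdd + (y.right : ℂ) * x.left.toAdd ↔ _
  constructor <;> intro h <;> linear_combination h

theorem eq_one_of_commute {x y z : ComplexAffineGroup} (hxy : x * y ≠ y * x)
    (hx : x * z = z * x) (hy : y * z = z * y) : z = 1 := by
  rw [ne_eq, mul_comm_iff] at hxy
  rw [mul_comm_iff] at hx hy
  have hw : (z.right : ℂ) = 1 := by
    have : (1 - (z.right : ℂ)) * ((1 - (y.right : ℂ)) * x.left.toAdd -
        (1 - (x.right : ℂ)) * y.left.toAdd) = 0 := by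
      linear_combination (1 - (y.right : ℂ)) * hx - (1 - (x.right : ℂ)) * hy
    rcases mul_eq_zero.mp this with h | h
    · exact (sub_eq_zero.mp h).symm
    · exact absurd (sub_eq_zero.mp h) hxy
  have hγ : z.left.toAdd = 0 := by
    by_contra hne
    simp only [hw, sub_self, zero_mul, zero_eq_mul, hne, or_false] at hx hy
    exact hxy (by simp [hx, hy])
  ext
  · exact hγ
  · exact hw

theorem eq_one_of_pow_eq_one {x : ComplexAffineGroup} {m : ℕ} (hm : m ≠ 0) (hx : x ^ m = 1)
    (hr : x.right = 1) : x = 1 := by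
  obtain ⟨α, u⟩ := x
  obtain rfl : u = 1 := hr
  have h : (SemidirectProduct.inl α : ComplexAffineGroup) ^ m = 1 := hx
  rw [← map_pow, ← map_one SemidirectProduct.inl, SemidirectProduct.inl_inj] at h
  have hα : m • α.toAdd = 0 := congrArg Multiplicative.toAdd h
  have : α = 1 := (smul_eq_zero.mp hα).resolve_left hm
  subst this
  rfl

end ComplexAffineGroup

/-- The characters of `G` which are the linear part of an affine action of `G` on the complex line
with noncommutative image. -/
def nonabelianAffineCharacters (G : Type*) [Group G] : Set (G →* ℂˣ) :=
  {χ | ∃ ρ : G →* ComplexAffineGroup,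
    SemidirectProduct.rightHom.comp ρ = χ ∧ ∃ g h, ρ g * ρ h ≠ ρ h * ρ g}

theorem comp_mem_nonabelianAffineCharacters {G H : Type*} [Group G] [Group H] (e : G ≃* H)
    {χ : H →* ℂˣ} (hχ : χ ∈ nonabelianAffineCharacters H) :
    χ.comp e.toMonoidHom ∈ nonabelianAffineCharacters G := by
  obtain ⟨ρ, rfl, g, h, hgh⟩ := hχ
  exact ⟨ρ.comp e.toMonoidHom, rfl, e.symm g, e.symm h, by simpa using hgh⟩

theorem ncard_nonabelianAffineCharacters_le {G H : Type*} [Group G] [Group H] (e : G ≃* H) (k : ℕ)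
    (hfin : {χ ∈ nonabelianAffineCharacters G | χ ^ k = 1}.Finite) :
    {χ ∈ nonabelianAffineCharacters H | χ ^ k = 1}.ncard ≤
      {χ ∈ nonabelianAffineCharacters G | χ ^ k = 1}.ncard := by
  refine Set.ncard_le_ncard_of_injOn (fun χ => χ.comp e.toMonoidHom) ?_ ?_ hfin
  · rintro χ ⟨hχ, hk⟩
    refine ⟨comp_mem_nonabelianAffineCharacters e hχ, ?_⟩
    ext g
    simpa using congrArg Units.val (DFunLike.congr_fun hk (e g))
  · intro χ _ ψ _ h
    ext g
    simpa using congrArg Units.val (DFunLike.congr_fun h (e.symm g))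

namespace TorusKnotGroup

variable {m n : ℕ}

theorem of_pow_eq_s14 :
    (PresentedGroup.of true : TorusKnotGroup m n) ^ m = PresentedGroup.of false ^ n := by
  have h : (PresentedGroup.mk
      ({FreeGroup.of true ^ m * (FreeGroup.of false ^ n)⁻¹} : Set (FreeGroup Bool)))
      (FreeGroup.of true ^ m * (FreeGroup.of false ^ n)⁻¹) = 1 :=
    PresentedGroup.one_of_mem rfl
  rw [map_mul, map_inv, mul_inv_eq_one, map_pow, map_pow] at h
  exact h

/-- The homomorphism out of `G_{m,n}` given by two elements with `xᵐ = yⁿ`. -/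
def lift {H : Type*} [Group H] (x y : H) (h : x ^ m = y ^ n) : TorusKnotGroup m n →* H :=
  PresentedGroup.toGroup (f := fun i => bif i then x else y) (by
    rintro r rfl
    simp [h])

@[simp]
theorem lift_true {H : Type*} [Group H] (x y : H) (h : x ^ m = y ^ n) :
    lift x y h (PresentedGroup.of true) = x :=
  PresentedGroup.toGroup.of _

@[simp]
theorem lift_false {H : Type*} [Group H] (x y : H) (h : x ^ m = y ^ n) :
    lift x y h (PresentedGroup.of false) = y :=
  PresentedGroup.toGroup.of _

theorem hom_ext {H : Type*} [Group H] {f g : TorusKnotGroup m n →* H}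
    (ht : f (PresentedGroup.of true) = g (PresentedGroup.of true))
    (hf : f (PresentedGroup.of false) = g (PresentedGroup.of false)) : f = g :=
  PresentedGroup.ext fun i => by cases i <;> assumption

theorem mem_of_generators_mem {K : Subgroup (TorusKnotGroup m n)}
    (ht : PresentedGroup.of true ∈ K) (hf : PresentedGroup.of false ∈ K)
    (g : TorusKnotGroup m n) : g ∈ K := by
  have h : Subgroup.closure (Set.range PresentedGroup.of) ≤ K := by
    rw [Subgroup.closure_le]
    rintro _ ⟨i, rfl⟩
    cases i <;> assumption
  rw [PresentedGroup.closure_range_of] at h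
  exact h (Subgroup.mem_top g)

theorem map_commute {H : Type*} [Group H] (ρ : TorusKnotGroup m n →* H)
    (hρ : Commute (ρ (PresentedGroup.of true)) (ρ (PresentedGroup.of false)))
    (g h : TorusKnotGroup m n) : Commute (ρ g) (ρ h) := by
  have key (z : H) (ht : Commute z (ρ (PresentedGroup.of true)))
      (hf : Commute z (ρ (PresentedGroup.of false))) (g : TorusKnotGroup m n) :
      Commute z (ρ g) :=
    Subgroup.mem_centralizer_singleton_iff.mp
      (mem_of_generators_mem (K := (Subgroup.centralizer {z}).comap ρ)
        (Subgroup.mem_centralizer_singleton_iff.mpr ht.eq.symm)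
        (Subgroup.mem_centralizer_singleton_iff.mpr hf.eq.symm) g) |>.symm
  exact key _ (key _ (.refl _) hρ g).symm (key _ hρ.symm (.refl _) g).symm h

theorem mem_nonabelianAffineCharacters_iff (hm : m ≠ 0) (hn : n ≠ 0)
    (χ : TorusKnotGroup m n →* ℂˣ) :
    χ ∈ nonabelianAffineCharacters (TorusKnotGroup m n) ↔
      (χ (PresentedGroup.of true) ^ m = 1 ∧ χ (PresentedGroup.of true) ≠ 1) ∧
      (χ (PresentedGroup.of false) ^ n = 1 ∧ χ (PresentedGroup.of false) ≠ 1) := by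
  constructor
  · rintro ⟨ρ, rfl, g, h, hgh⟩
    simp only [MonoidHom.comp_apply, ← map_pow, of_pow_eq_s14]
    have hρ : ρ (PresentedGroup.of true) * ρ (PresentedGroup.of false) ≠
        ρ (PresentedGroup.of false) * ρ (PresentedGroup.of true) :=
      fun hc => hgh (map_commute ρ hc g h)
    have hpow : ρ (PresentedGroup.of true) ^ m = ρ (PresentedGroup.of false) ^ n := by
      rw [← map_pow, ← map_pow, of_pow_eq_s14]
    have hy : ρ (PresentedGroup.of false) ^ n = 1 :=
      ComplexAffineGroup.eq_one_of_commute hρ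
        (hpow ▸ (Commute.self_pow _ m).eq) (Commute.self_pow _ n).eq
    refine ⟨⟨?_, fun h1 => hρ ?_⟩, ?_, fun h1 => hρ ?_⟩
    · rw [map_pow, hy, map_one]
    · rw [ComplexAffineGroup.eq_one_of_pow_eq_one hm (hpow.trans hy) h1, one_mul, mul_one]
    · rw [map_pow, hy, map_one]
    · rw [ComplexAffineGroup.eq_one_of_pow_eq_one hn hy h1, one_mul, mul_one]
  · rintro ⟨⟨hu, hu1⟩, hv, hv1⟩
    set u := χ (PresentedGroup.of true)
    set v := χ (PresentedGroup.of false)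
    let t : ComplexAffineGroup := SemidirectProduct.inl (Multiplicative.ofAdd 1)
    let x : ComplexAffineGroup := SemidirectProduct.inr u
    let y : ComplexAffineGroup := t * SemidirectProduct.inr v * t⁻¹
    have hxy : x ^ m = y ^ n := by
      simp only [x, y, conj_pow, ← map_pow, hu, hv, map_one, mul_one, mul_inv_cancel]
    refine ⟨lift x y hxy, hom_ext ?_ ?_, PresentedGroup.of true, PresentedGroup.of false, ?_⟩
    · exact congrArg SemidirectProduct.rightHom (lift_true x y hxy)
    · refine (congrArg SemidirectProduct.rightHom (lift_false x y hxy)).trans ?_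
      change 1 * v * 1⁻¹ = v
      simp
    · rw [lift_true, lift_false, ne_eq, ComplexAffineGroup.mul_comm_iff]
      have hx : x.left.toAdd = 0 := rfl
      have hxr : x.right = u := rfl
      have hy : y.left.toAdd = 1 - (v : ℂ) := by
        simp only [y, t, SemidirectProduct.mul_left, SemidirectProduct.mul_right,
          SemidirectProduct.left_inl, SemidirectProduct.right_inl, SemidirectProduct.left_inr,
          SemidirectProduct.right_inr, ← map_inv, toAdd_mul, map_one, one_mul]
        change (1 : ℂ) + 0 + (v : ℂ) * (-1) = _
        ring
      rw [hx, hxr, hy, mul_zero, zero_eq_mul, sub_eq_zero, sub_eq_zero]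
      rintro (h | h)
      · exact hu1 (Units.ext h.symm)
      · exact hv1 (Units.ext h.symm)

end TorusKnotGroup

theorem Complex.finite_and_ncard_units_pow_eq_one_ne_one {d : ℕ} (hd : d ≠ 0) :
    {u : ℂˣ | u ^ d = 1 ∧ u ≠ 1}.Finite ∧ {u : ℂˣ | u ^ d = 1 ∧ u ≠ 1}.ncard = d - 1 := by
  have : NeZero d := ⟨hd⟩
  have heq : {u : ℂˣ | u ^ d = 1 ∧ u ≠ 1} = (rootsOfUnity d ℂ : Set ℂˣ) \ {1} := by
    ext u
    simp
  have hfin : (rootsOfUnity d ℂ : Set ℂˣ).Finite :=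
    inferInstanceAs (Finite (rootsOfUnity d ℂ))
  refine heq ▸ ⟨hfin.sdiff, ?_⟩
  rw [Set.ncard_sdiff_singleton_of_mem (one_mem _)]
  congr 1
  rw [← Nat.card_coe_set_eq]
  exact Complex.card_rootsOfUnity d

namespace TorusKnotGroup

theorem finite_and_ncard_nonabelianAffineCharacters {m n : ℕ} (hm : m ≠ 0) (hn : n ≠ 0) (k : ℕ) :
    {χ ∈ nonabelianAffineCharacters (TorusKnotGroup m n) | χ ^ k = 1}.Finite ∧
    {χ ∈ nonabelianAffineCharacters (TorusKnotGroup m n) | χ ^ k = 1}.ncard =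
      (m.gcd k - 1) * (n.gcd k - 1) := by
  obtain ⟨hfm, hcm⟩ :=
    Complex.finite_and_ncard_units_pow_eq_one_ne_one (Nat.gcd_ne_zero_left (n := k) hm)
  obtain ⟨hfn, hcn⟩ :=
    Complex.finite_and_ncard_units_pow_eq_one_ne_one (Nat.gcd_ne_zero_left (n := k) hn)
  have hbij : Set.BijOn (fun χ : TorusKnotGroup m n →* ℂˣ =>
      (χ (PresentedGroup.of true), χ (PresentedGroup.of false)))
      {χ ∈ nonabelianAffineCharacters (TorusKnotGroup m n) | χ ^ k = 1}
      ({u : ℂˣ | u ^ m.gcd k = 1 ∧ u ≠ 1} ×ˢ {u : ℂˣ | u ^ n.gcd k = 1 ∧ u ≠ 1}) := by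
    refine ⟨?_, ?_, ?_⟩
    · rintro χ ⟨hχ, hk⟩
      obtain ⟨⟨hu, hu1⟩, hv, hv1⟩ := (mem_nonabelianAffineCharacters_iff hm hn χ).mp hχ
      exact ⟨⟨pow_gcd_eq_one.mpr ⟨hu, DFunLike.congr_fun hk _⟩, hu1⟩,
        pow_gcd_eq_one.mpr ⟨hv, DFunLike.congr_fun hk _⟩, hv1⟩
    · intro χ _ ψ _ h
      exact hom_ext (congrArg Prod.fst h) (congrArg Prod.snd h)
    · rintro ⟨u, v⟩ ⟨⟨hu, hu1⟩, hv, hv1⟩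
      obtain ⟨hum, huk⟩ := pow_gcd_eq_one.mp hu
      obtain ⟨hvn, hvk⟩ := pow_gcd_eq_one.mp hv
      refine ⟨lift u v (hum.trans hvn.symm), ⟨?_, hom_ext ?_ ?_⟩, by simp⟩
      · rw [mem_nonabelianAffineCharacters_iff hm hn]
        simpa using ⟨⟨hum, hu1⟩, hvn, hv1⟩
      · simpa using huk
      · simpa using hvk
  refine ⟨hbij.finite_iff_finite.mpr (hfm.prod hfn), ?_⟩
  rw [← hcm, ← hcn, ← Set.ncard_prod, ← hbij.image_eq, hbij.injOn.ncard_image]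

theorem gcd_sub_one_mul_eq {m n p q : ℕ} (hm : m ≠ 0) (hn : n ≠ 0) (hp : p ≠ 0) (hq : q ≠ 0)
    (e : TorusKnotGroup m n ≃* TorusKnotGroup p q) (k : ℕ) :
    (m.gcd k - 1) * (n.gcd k - 1) = (p.gcd k - 1) * (q.gcd k - 1) := by
  obtain ⟨hf, hc⟩ := finite_and_ncard_nonabelianAffineCharacters hm hn k
  obtain ⟨hf', hc'⟩ := finite_and_ncard_nonabelianAffineCharacters hp hq k
  rw [← hc, ← hc']
  exact le_antisymm (ncard_nonabelianAffineCharacters_le e.symm k hf')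
    (ncard_nonabelianAffineCharacters_le e k hf)

end TorusKnotGroup

theorem Nat.eq_and_eq_of_sub_one_mul_sub_one_le {a b c d : ℕ} (hc : 1 < c) (hd : 1 < d)
    (hac : a ≤ c) (hbd : b ≤ d) (h : (c - 1) * (d - 1) ≤ (a - 1) * (b - 1)) :
    a = c ∧ b = d := by
  obtain ⟨c, rfl⟩ : ∃ c', c = c' + 2 := ⟨c - 2, by omega⟩
  obtain ⟨d, rfl⟩ : ∃ d', d = d' + 2 := ⟨d - 2, by omega⟩
  have h1 : (a - 1) * (b - 1) ≤ (a - 1) * (d + 1) := Nat.mul_le_mul_left _ (by omega)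
  have h2 : (a - 1) * (b - 1) ≤ (c + 1) * (b - 1) := Nat.mul_le_mul_right _ (by omega)
  have h3 := Nat.le_of_mul_le_mul_right (h.trans h1) (by omega)
  have h4 := Nat.le_of_mul_le_mul_left (h.trans h2) (by omega)
  omega

theorem Nat.lcm_dvd_lcm_of_gcd_sub_one_mul_eq {m n p q : ℕ}
    (hp : 1 < p) (hq : 1 < q)
    (h : ∀ k, (m.gcd k - 1) * (n.gcd k - 1) = (p.gcd k - 1) * (q.gcd k - 1)) :
    p.lcm q ∣ m.lcm n := by
  have h0 := h 0
  have hL := h (m.lcm n)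
  rw [Nat.gcd_eq_left (Nat.dvd_lcm_left m n), Nat.gcd_eq_left (Nat.dvd_lcm_right m n)] at hL
  simp only [Nat.gcd_zero_right] at h0
  obtain ⟨h1, h2⟩ := Nat.eq_and_eq_of_sub_one_mul_sub_one_le hp hq
    (Nat.gcd_le_left (m.lcm n) (by omega)) (Nat.gcd_le_left (m.lcm n) (by omega))
    (h0.symm.trans hL).le
  exact Nat.lcm_dvd (Nat.gcd_eq_left_iff_dvd.mp h1) (Nat.gcd_eq_left_iff_dvd.mp h2)

theorem Nat.gcd_dvd_gcd_of_gcd_sub_one_mul_eq {m n p q : ℕ} (hm : 1 < m)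
    (h : ∀ k, (m.gcd k - 1) * (n.gcd k - 1) = (p.gcd k - 1) * (q.gcd k - 1)) :
    m.gcd n ∣ p.gcd q := by
  have hpos : 0 < m.gcd n := Nat.gcd_pos_of_pos_left n (by omega)
  rcases (show 1 ≤ m.gcd n from hpos).eq_or_lt with h1 | h1
  · simp [← h1]
  have hd := h (m.gcd n)
  rw [Nat.gcd_eq_right (Nat.gcd_dvd_left m n), Nat.gcd_eq_right (Nat.gcd_dvd_right m n)] at hd
  obtain ⟨h2, h3⟩ := Nat.eq_and_eq_of_sub_one_mul_sub_one_le h1 h1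
    (Nat.gcd_le_right p hpos) (Nat.gcd_le_right q hpos) hd.le
  exact Nat.dvd_gcd (Nat.gcd_eq_right_iff_dvd.mp h2) (Nat.gcd_eq_right_iff_dvd.mp h3)

/-- For integers `m ≥ n > 1` and `p ≥ q > 1`, if the presented
groups `G_{m,n} = ⟨a, b | aᵐ = bⁿ⟩` and `G_{p,q} = ⟨a, b | aᵖ = b^q⟩` are
isomorphic, then `m = p` and `n = q`; i.e. `m, n > 1` are uniquely determined
by `G_{m,n}`. -/
theorem torusKnotGroup_determines_m_n (m n p q : ℕ)
    (hn : 1 < n) (hnm : n ≤ m) (hq : 1 < q) (hqp : q ≤ p)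
    (h : Nonempty (TorusKnotGroup m n ≃* TorusKnotGroup p q)) :
    m = p ∧ n = q := by
  obtain ⟨e⟩ := h
  have hm : 1 < m := hn.trans_le hnm
  have hp : 1 < p := hq.trans_le hqp
  have hcard := TorusKnotGroup.gcd_sub_one_mul_eq (by omega) (by omega) (by omega) (by omega) e
  have hlcm : m.lcm n = p.lcm q := Nat.dvd_antisymm
    (Nat.lcm_dvd_lcm_of_gcd_sub_one_mul_eq hm hn fun k => (hcard k).symm)
    (Nat.lcm_dvd_lcm_of_gcd_sub_one_mul_eq hp hq hcard)
  have hgcd : m.gcd n = p.gcd q := Nat.dvd_antisymm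
    (Nat.gcd_dvd_gcd_of_gcd_sub_one_mul_eq hm hcard)
    (Nat.gcd_dvd_gcd_of_gcd_sub_one_mul_eq hp fun k => (hcard k).symm)
  have hmul : m * n = p * q := by
    rw [← Nat.gcd_mul_lcm m n, ← Nat.gcd_mul_lcm p q, hgcd, hlcm]
  have h0 := hcard 0
  simp only [Nat.gcd_zero_right] at h0
  zify [hm.le, hn.le, hp.le, hq.le] at h0 hmul hnm hqp ⊢
  have hsum : (m : ℤ) + n = p + q := by linear_combination hmul - h0
  have hprod : ((m : ℤ) - p) * (m - q) = 0 := by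
    linear_combination (m : ℤ) * hsum - hmul
  rcases mul_eq_zero.mp hprod with h | h <;> constructor <;> linarith
end

section
/- The presented group ⟨a₁, a₂ | a₂a₁a₂ = a₁a₂a₁⟩ (the Wirtinger presentation of the trefoil knot group after eliminating one generator) is isomorphic to the presented group ⟨a, b | a² = b³⟩. -/
/-- The trefoil knot group in its Wirtinger presentation with two generators:
`⟨a₁, a₂ | a₂a₁a₂ = a₁a₂a₁⟩`, where `a₁` corresponds to `true` and `a₂` to
`false`; the relator is `a₂a₁a₂a₁⁻¹a₂⁻¹a₁⁻¹`. -/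
abbrev TrefoilWirtinger2 : Type :=
  PresentedGroup
    ({FreeGroup.of false * FreeGroup.of true * FreeGroup.of false *
        (FreeGroup.of true)⁻¹ * (FreeGroup.of false)⁻¹ * (FreeGroup.of true)⁻¹} :
      Set (FreeGroup Bool))

/-- The presented group `⟨a, b | a² = b³⟩`, where `a` corresponds to `true` and
`b` to `false`. -/
abbrev TrefoilTorus : Type :=
  PresentedGroup ({FreeGroup.of true ^ 2 * (FreeGroup.of false ^ 3)⁻¹} : Set (FreeGroup Bool))

theorem TrefoilWirtinger2.braid_relation :
    (PresentedGroup.of false * PresentedGroup.of true * PresentedGroup.of false :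
      TrefoilWirtinger2) =
      PresentedGroup.of true * PresentedGroup.of false * PresentedGroup.of true := by
  refine PresentedGroup.mk_eq_mk_of_mul_inv_mem
    (x := FreeGroup.of false * FreeGroup.of true * FreeGroup.of false)
    (y := FreeGroup.of true * FreeGroup.of false * FreeGroup.of true) ?_
  simp [mul_assoc]

theorem TrefoilTorus.sq_eq_cube :
    (PresentedGroup.of true ^ 2 : TrefoilTorus) = PresentedGroup.of false ^ 3 :=
  PresentedGroup.mk_eq_mk_of_mul_inv_mem (x := FreeGroup.of true ^ 2)
    (y := FreeGroup.of false ^ 3) rfl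

/-- In any group, `x = b⁻¹a` and `y = a⁻¹b²` satisfy the braid relation if `a² = b³`. -/
theorem braid_relation_of_sq_eq_cube {G : Type*} [Group G] {a b : G} (h : a ^ 2 = b ^ 3) :
    (a⁻¹ * b ^ 2) * (b⁻¹ * a) * (a⁻¹ * b ^ 2) * (b⁻¹ * a)⁻¹ * (a⁻¹ * b ^ 2)⁻¹ * (b⁻¹ * a)⁻¹ =
      1 :=
  calc
    _ = a⁻¹ * b ^ 3 * a⁻¹ := by group
    _ = 1 := by rw [← h]; group

/-- In any group, `a = xyx` and `b = xy` satisfy `a² = b³` if `yxy = xyx`. -/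
theorem sq_eq_cube_of_braid_relation {G : Type*} [Group G] {x y : G}
    (h : y * x * y = x * y * x) : (x * y * x) ^ 2 * ((x * y) ^ 3)⁻¹ = 1 := by
  rw [mul_inv_eq_one]
  calc
    (x * y * x) ^ 2 = (x * y * x) * (y * x * y) := by rw [h, sq]
    _ = (x * y) ^ 3 := by simp only [pow_succ, pow_zero, one_mul, mul_assoc]

/-- The homomorphism `a₁ ↦ b⁻¹a`, `a₂ ↦ a⁻¹b²`. -/
def TrefoilWirtinger2.toTorus : TrefoilWirtinger2 →* TrefoilTorus :=
  PresentedGroup.toGroup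
    (f := fun i ↦ cond i ((PresentedGroup.of false)⁻¹ * PresentedGroup.of true)
      ((PresentedGroup.of true)⁻¹ * PresentedGroup.of false ^ 2)) <| by
    rintro r rfl
    simpa only [map_mul, map_inv, FreeGroup.lift_apply_of, cond_true, cond_false] using
      braid_relation_of_sq_eq_cube TrefoilTorus.sq_eq_cube

/-- The homomorphism `a ↦ a₁a₂a₁`, `b ↦ a₁a₂`. -/
def TrefoilTorus.toWirtinger2 : TrefoilTorus →* TrefoilWirtinger2 :=
  PresentedGroup.toGroup
    (f := fun i ↦ cond i
      (PresentedGroup.of true * PresentedGroup.of false * PresentedGroup.of true)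
      (PresentedGroup.of true * PresentedGroup.of false)) <| by
    rintro r rfl
    simpa only [map_mul, map_inv, map_pow, FreeGroup.lift_apply_of, cond_true, cond_false] using
      sq_eq_cube_of_braid_relation TrefoilWirtinger2.braid_relation

/-- `⟨a₁, a₂ | a₂a₁a₂ = a₁a₂a₁⟩ ≅ ⟨a, b | a² = b³⟩`. -/
theorem trefoil_wirtinger_two_gen_iso : Nonempty (TrefoilWirtinger2 ≃* TrefoilTorus) := by
  refine ⟨MonoidHom.toMulEquiv TrefoilWirtinger2.toTorus TrefoilTorus.toWirtinger2
    (PresentedGroup.ext ?_) (PresentedGroup.ext ?_)⟩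
  · rintro (_ | _)
    · simp only [TrefoilWirtinger2.toTorus, TrefoilTorus.toWirtinger2, MonoidHom.comp_apply,
        PresentedGroup.toGroup.of, cond_true, cond_false, map_mul, map_inv, map_pow,
        MonoidHom.id_apply]
      rw [inv_mul_eq_iff_eq_mul, sq]
      simp only [mul_assoc]
    · simp [TrefoilWirtinger2.toTorus, TrefoilTorus.toWirtinger2, mul_assoc]
  · rintro (_ | _) <;>
      simp only [TrefoilWirtinger2.toTorus, TrefoilTorus.toWirtinger2, MonoidHom.comp_apply,
        PresentedGroup.toGroup.of, cond_true, cond_false, map_mul, MonoidHom.id_apply] <;>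
      group
end

section
/- The presented group ⟨a₁, a₂, a₃ | a₁a₂ = a₃a₁, a₂a₃ = a₁a₂, a₃a₁ = a₂a₃⟩ (the Wirtinger presentation of the trefoil knot group with three generators) is isomorphic to the presented group ⟨a, b | a² = b³⟩. -/
/-- The trefoil knot group in its Wirtinger presentation with three generators:
`⟨a₁, a₂, a₃ | a₁a₂ = a₃a₁, a₂a₃ = a₁a₂, a₃a₁ = a₂a₃⟩`, with relators
`a₁a₂a₁⁻¹a₃⁻¹`, `a₂a₃a₂⁻¹a₁⁻¹`, `a₃a₁a₃⁻¹a₂⁻¹` (here `aᵢ` corresponds to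
`i - 1 : Fin 3`). -/
abbrev TrefoilWirtinger3 : Type :=
  PresentedGroup
    ({FreeGroup.of 0 * FreeGroup.of 1 * (FreeGroup.of 0)⁻¹ * (FreeGroup.of 2)⁻¹,
      FreeGroup.of 1 * FreeGroup.of 2 * (FreeGroup.of 1)⁻¹ * (FreeGroup.of 0)⁻¹,
      FreeGroup.of 2 * FreeGroup.of 0 * (FreeGroup.of 2)⁻¹ * (FreeGroup.of 1)⁻¹} :
      Set (FreeGroup (Fin 3)))

namespace TrefoilWirtinger3

/-- The `i`-th Wirtinger generator. -/
def gen (i : Fin 3) : TrefoilWirtinger3 := PresentedGroup.of i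

lemma gen_zero_mul_gen_one : gen 0 * gen 1 = gen 2 * gen 0 :=
  mul_inv_eq_iff_eq_mul.1 (mul_inv_eq_one.1
    (PresentedGroup.one_of_mem (Set.mem_insert _ _)))

lemma gen_one_mul_gen_two : gen 1 * gen 2 = gen 0 * gen 1 :=
  mul_inv_eq_iff_eq_mul.1 (mul_inv_eq_one.1
    (PresentedGroup.one_of_mem (Set.mem_insert_of_mem _ (Set.mem_insert _ _))))

lemma gen_two_eq : gen 2 = gen 0 * gen 1 * (gen 0)⁻¹ :=
  eq_mul_inv_of_mul_eq gen_zero_mul_gen_one.symm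

/-- The braid relation between the first two Wirtinger generators. -/
lemma braid : gen 0 * gen 1 * gen 0 = gen 1 * gen 0 * gen 1 := by
  rw [← gen_one_mul_gen_two, mul_assoc, ← gen_zero_mul_gen_one]
  exact (mul_assoc _ _ _).symm

/-- The homomorphism `a ↦ a₁a₂a₁`, `b ↦ a₁a₂`. -/
def ofTorus : TrefoilTorus →* TrefoilWirtinger3 :=
  PresentedGroup.toGroup
    (f := fun i ↦ cond i (gen 0 * gen 1 * gen 0) (gen 0 * gen 1)) <| by
    rintro r rfl
    have h : (gen 0 * gen 1 * gen 0) ^ 2 = (gen 0 * gen 1) ^ 3 := by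
      rw [sq]
      nth_rewrite 2 [braid]
      simp only [pow_succ, pow_zero, one_mul, mul_assoc]
    simpa [mul_inv_eq_one] using h

end TrefoilWirtinger3

namespace TrefoilTorus

/-- The generators `a = gen true` and `b = gen false`. -/
def gen (i : Bool) : TrefoilTorus := PresentedGroup.of i

lemma gen_true_sq : gen true ^ 2 = gen false ^ 3 :=
  mul_inv_eq_one.1 (PresentedGroup.one_of_mem (Set.mem_singleton _))

/-- The homomorphism `a₁ ↦ b⁻¹a`, `a₂ ↦ a⁻¹b²`, `a₃ ↦ ba⁻¹b`. -/
def ofWirtinger : TrefoilWirtinger3 →* TrefoilTorus :=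
  PresentedGroup.toGroup
    (f := ![(gen false)⁻¹ * gen true, (gen true)⁻¹ * gen false ^ 2,
      gen false * (gen true)⁻¹ * gen false]) <| by
    have h : (gen true)⁻¹ * gen false ^ 2 * (gen false * (gen true)⁻¹ * gen false) =
        gen false := by
      calc
        _ = (gen true)⁻¹ * gen false ^ 3 * (gen true)⁻¹ * gen false := by group
        _ = gen false := by rw [← gen_true_sq]; group
    rintro r (rfl | rfl | rfl) <;>
      simp only [map_mul, map_inv, FreeGroup.lift_apply_of,
        mul_inv_eq_iff_eq_mul, Matrix.cons_val]
    · group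
    · rw [h]; group
    · rw [one_mul, h]; group

end TrefoilTorus

/-- `⟨a₁, a₂, a₃ | a₁a₂ = a₃a₁, a₂a₃ = a₁a₂, a₃a₁ = a₂a₃⟩ ≅
⟨a, b | a² = b³⟩`. -/
theorem trefoil_wirtinger_three_gen_iso : Nonempty (TrefoilWirtinger3 ≃* TrefoilTorus) := by
  refine ⟨MonoidHom.toMulEquiv TrefoilTorus.ofWirtinger TrefoilWirtinger3.ofTorus ?_ ?_⟩
  · ext i
    change TrefoilWirtinger3.ofTorus (TrefoilTorus.ofWirtinger (.of i)) = .of i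
    change _ = TrefoilWirtinger3.gen i
    fin_cases i <;>
      simp [TrefoilTorus.ofWirtinger, TrefoilWirtinger3.ofTorus, TrefoilTorus.gen,
        TrefoilWirtinger3.gen_two_eq, sq, mul_assoc]
  · ext i
    change TrefoilTorus.ofWirtinger (TrefoilWirtinger3.ofTorus (.of i)) = .of i
    change _ = TrefoilTorus.gen i
    cases i <;>
      simp [TrefoilTorus.ofWirtinger, TrefoilWirtinger3.ofTorus, TrefoilWirtinger3.gen,
        sq, mul_assoc]
end

section
/- The presented group ⟨a₁, a₂, a₃, a₄, a₅ | a₄a₁ = a₂a₄, a₁a₃ = a₄a₁, a₂a₅ = a₁a₂, a₅a₂ = a₃a₅, a₃a₄ = a₅a₃⟩ (the Wirtinger presentation of a five-crossing knot group) is isomorphic to the two-generator presented group ⟨a₂, a₅ | a₂a₅a₂⁻¹a₅ = a₅a₂⁻¹a₅⁻¹a₂a₅⁻¹a₂a₅a₂⁻¹a₅a₂⟩. -/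
/-- The Wirtinger presentation of a five-crossing knot group:
`⟨a₁, a₂, a₃, a₄, a₅ | a₄a₁ = a₂a₄, a₁a₃ = a₄a₁, a₂a₅ = a₁a₂, a₅a₂ = a₃a₅,
a₃a₄ = a₅a₃⟩`, with relators `a₄a₁a₄⁻¹a₂⁻¹`, `a₁a₃a₁⁻¹a₄⁻¹`, `a₂a₅a₂⁻¹a₁⁻¹`,
`a₅a₂a₅⁻¹a₃⁻¹`, `a₃a₄a₃⁻¹a₅⁻¹` (here `aᵢ` corresponds to `i - 1 : Fin 5`). -/
abbrev FiveCrossingWirtinger : Type :=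
  PresentedGroup
    ({FreeGroup.of 3 * FreeGroup.of 0 * (FreeGroup.of 3)⁻¹ * (FreeGroup.of 1)⁻¹,
      FreeGroup.of 0 * FreeGroup.of 2 * (FreeGroup.of 0)⁻¹ * (FreeGroup.of 3)⁻¹,
      FreeGroup.of 1 * FreeGroup.of 4 * (FreeGroup.of 1)⁻¹ * (FreeGroup.of 0)⁻¹,
      FreeGroup.of 4 * FreeGroup.of 1 * (FreeGroup.of 4)⁻¹ * (FreeGroup.of 2)⁻¹,
      FreeGroup.of 2 * FreeGroup.of 3 * (FreeGroup.of 2)⁻¹ * (FreeGroup.of 4)⁻¹} :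
      Set (FreeGroup (Fin 5)))

/-- The two-generator presentation
`⟨a₂, a₅ | a₂a₅a₂⁻¹a₅ = a₅a₂⁻¹a₅⁻¹a₂a₅⁻¹a₂a₅a₂⁻¹a₅a₂⟩`, where `a₂` corresponds
to `true` and `a₅` to `false`; the single relator is
`(a₂a₅a₂⁻¹a₅) * (a₅a₂⁻¹a₅⁻¹a₂a₅⁻¹a₂a₅a₂⁻¹a₅a₂)⁻¹`. -/
abbrev FiveCrossingTwoGen : Type :=
  PresentedGroup
    ({(FreeGroup.of true * FreeGroup.of false * (FreeGroup.of true)⁻¹ * FreeGroup.of false) *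
        (FreeGroup.of false * (FreeGroup.of true)⁻¹ * (FreeGroup.of false)⁻¹ *
          FreeGroup.of true * (FreeGroup.of false)⁻¹ * FreeGroup.of true *
          FreeGroup.of false * (FreeGroup.of true)⁻¹ * FreeGroup.of false *
          FreeGroup.of true)⁻¹} : Set (FreeGroup Bool))

/-- Inverting both generators turns the relator of the two-generator presentation into a conjugate
of the relator obtained by eliminating `a₁`, `a₃`, `a₄` from the Wirtinger presentation. -/
theorem two_gen_relator_inv_eq_conj {G : Type*} [Group G] (x y : G) :
    (x⁻¹ * y⁻¹ * x⁻¹⁻¹ * y⁻¹) *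
      (y⁻¹ * x⁻¹⁻¹ * y⁻¹⁻¹ * x⁻¹ * y⁻¹⁻¹ * x⁻¹ * y⁻¹ * x⁻¹⁻¹ * y⁻¹ * x⁻¹)⁻¹ =
    (x⁻¹ * y⁻¹ * x * y⁻¹) *
      ((x * y * x⁻¹ * y * x * y⁻¹) * (y * x⁻¹ * y * x * y⁻¹ * x * y * x⁻¹)⁻¹) *
      (x⁻¹ * y⁻¹ * x * y⁻¹)⁻¹ := by
  group

theorem two_gen_relator_inv_eq_one_iff {G : Type*} [Group G] (x y : G) :
    (x⁻¹ * y⁻¹ * x⁻¹⁻¹ * y⁻¹) *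
      (y⁻¹ * x⁻¹⁻¹ * y⁻¹⁻¹ * x⁻¹ * y⁻¹⁻¹ * x⁻¹ * y⁻¹ * x⁻¹⁻¹ * y⁻¹ * x⁻¹)⁻¹ = 1 ↔
    x * y * x⁻¹ * y * x * y⁻¹ = y * x⁻¹ * y * x * y⁻¹ * x * y * x⁻¹ := by
  rw [two_gen_relator_inv_eq_conj, conj_eq_one_iff, mul_inv_eq_one]

/-- The images of `a₁, …, a₅` when `a₂ ↦ x` and `a₅ ↦ y`. -/
def wirtingerImage {G : Type*} [Group G] (x y : G) : Fin 5 → G :=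
  ![x * y * x⁻¹, x, y * x * y⁻¹, y * x⁻¹ * y * x * y⁻¹, y]

/-- The homomorphism from the Wirtinger group given by a pair satisfying the eliminated relation. -/
def wirtingerLift {G : Type*} [Group G] (x y : G)
    (h : x * y * x⁻¹ * y * x * y⁻¹ = y * x⁻¹ * y * x * y⁻¹ * x * y * x⁻¹) :
    FiveCrossingWirtinger →* G :=
  PresentedGroup.toGroup (f := wirtingerImage x y) (by
    rintro r (rfl | rfl | rfl | rfl | rfl) <;>
      simp only [map_mul, map_inv, FreeGroup.lift_apply_of, wirtingerImage, Matrix.cons_val,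
        mul_inv_eq_iff_eq_mul]
    · simpa [mul_assoc] using h.symm
    · simpa [mul_assoc] using h
    all_goals group)

/-- The homomorphism from the two-generator group given by the inverses of a pair satisfying the
eliminated relation. -/
def twoGenLift {G : Type*} [Group G] (x y : G)
    (h : x * y * x⁻¹ * y * x * y⁻¹ = y * x⁻¹ * y * x * y⁻¹ * x * y * x⁻¹) :
    FiveCrossingTwoGen →* G :=
  PresentedGroup.toGroup (f := fun i : Bool => if i then x⁻¹ else y⁻¹) (by
    rintro r rfl
    simpa only [map_mul, map_inv, FreeGroup.lift_apply_of, if_true, Bool.false_eq_true, if_false]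
      using (two_gen_relator_inv_eq_one_iff x y).2 h)

/-- The Wirtinger relations express every generator through `a₂` and `a₅`. -/
theorem wirtinger_of_eq_image (i : Fin 5) :
    (PresentedGroup.of i : FiveCrossingWirtinger) =
      wirtingerImage (PresentedGroup.of 1) (PresentedGroup.of 4) i := by
  have h₁ : (PresentedGroup.of 1 * PresentedGroup.of 4 * (PresentedGroup.of 1)⁻¹ *
      (PresentedGroup.of 0)⁻¹ : FiveCrossingWirtinger) = 1 :=
    PresentedGroup.one_of_mem (by simp)
  have h₃ : (PresentedGroup.of 4 * PresentedGroup.of 1 * (PresentedGroup.of 4)⁻¹ *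
      (PresentedGroup.of 2)⁻¹ : FiveCrossingWirtinger) = 1 :=
    PresentedGroup.one_of_mem (by simp)
  have h₄ : (PresentedGroup.of 2 * PresentedGroup.of 3 * (PresentedGroup.of 2)⁻¹ *
      (PresentedGroup.of 4)⁻¹ : FiveCrossingWirtinger) = 1 :=
    PresentedGroup.one_of_mem (by simp)
  rw [mul_inv_eq_one] at h₁ h₃ h₄
  fin_cases i
  · exact h₁.symm
  · rfl
  · exact h₃.symm
  · rw [mul_inv_eq_iff_eq_mul, ← eq_inv_mul_iff_mul_eq, ← h₃] at h₄
    refine h₄.trans ?_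
    simp [wirtingerImage, mul_assoc]
  · rfl

theorem wirtinger_eliminated_relation :
    (PresentedGroup.of 1 * PresentedGroup.of 4 * (PresentedGroup.of 1)⁻¹ *
      PresentedGroup.of 4 * PresentedGroup.of 1 * (PresentedGroup.of 4)⁻¹ :
      FiveCrossingWirtinger) =
    PresentedGroup.of 4 * (PresentedGroup.of 1)⁻¹ * PresentedGroup.of 4 * PresentedGroup.of 1 *
      (PresentedGroup.of 4)⁻¹ * PresentedGroup.of 1 * PresentedGroup.of 4 *
      (PresentedGroup.of 1)⁻¹ := by
  have h : (PresentedGroup.of 0 * PresentedGroup.of 2 * (PresentedGroup.of 0)⁻¹ *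
      (PresentedGroup.of 3)⁻¹ : FiveCrossingWirtinger) = 1 :=
    PresentedGroup.one_of_mem (by simp)
  rw [mul_inv_eq_one, mul_inv_eq_iff_eq_mul, wirtinger_of_eq_image 0, wirtinger_of_eq_image 2,
    wirtinger_of_eq_image 3] at h
  simpa [wirtingerImage, mul_assoc] using h

theorem two_gen_inv_eliminated_relation (x y : FiveCrossingTwoGen)
    (hx : x = (PresentedGroup.of true)⁻¹) (hy : y = (PresentedGroup.of false)⁻¹) :
    x * y * x⁻¹ * y * x * y⁻¹ = y * x⁻¹ * y * x * y⁻¹ * x * y * x⁻¹ := by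
  rw [← two_gen_relator_inv_eq_one_iff]
  subst hx hy
  simp only [inv_inv]
  exact PresentedGroup.one_of_mem rfl

/-- The five-generator Wirtinger presentation above is isomorphic
to the two-generator presentation
`⟨a₂, a₅ | a₂a₅a₂⁻¹a₅ = a₅a₂⁻¹a₅⁻¹a₂a₅⁻¹a₂a₅a₂⁻¹a₅a₂⟩`. -/
theorem five_crossing_wirtinger_iso :
    Nonempty (FiveCrossingWirtinger ≃* FiveCrossingTwoGen) := by
  refine ⟨MonoidHom.toMulEquiv
    (wirtingerLift _ _ (two_gen_inv_eliminated_relation _ _ rfl rfl))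
    (twoGenLift _ _ wirtinger_eliminated_relation) ?_ ?_⟩
  · refine PresentedGroup.ext fun i => ?_
    refine Eq.trans ?_ (wirtinger_of_eq_image i).symm
    fin_cases i <;>
      simp [wirtingerLift, twoGenLift, wirtingerImage]
  · refine PresentedGroup.ext fun i => ?_
    cases i <;> simp [wirtingerLift, twoGenLift, wirtingerImage]
end
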